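/- arXiv:1302.3150 — 5 statements merged into one kernel-verified Lean document; each statement's English description precedes it below -/
import Mathlib

section
/- Let b > 0, c be constants and m ≥ 1 an integer, and let φ(s) = √(b²−s²)/b + √(b²−s²)∫₀ˢ c·(t²)^{m−1/2}(b²−t²)^{−3/2} dt. On U = ℝ² ∖ {0} define σ(x) = (m − 1)ln[(x¹)² + (x²)²], α = e^{σ(x)}√((y¹)²+(y²)²), and β = b·e^{σ(x)}(x²y¹ − x¹y²)/√((x¹)²+(x²)²). Then F = αφ(β/α) satisfies the Hamel equations F_{x^my^l}y^m − F_{x^l} = 0 at all (x,y) with x ∈ U, y ≠ 0 and |β(x,y)| < b·α(x,y) (hence F is projectively flat), while the 1-form β is not closed. -/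
open scoped BigOperators
open Real

noncomputable section

/-- Points (and vectors) of the plane. -/
abbrev Pt : Type := Fin 2 → ℝ

/-- Partial derivative of a scalar function on `ℝ²` in the `j`-th coordinate direction. -/
def pd (f : Pt → ℝ) (j : Fin 2) (x : Pt) : ℝ := fderiv ℝ f x (Pi.single j 1)

/-- Christoffel symbols `γ^k_{ij}` of a Riemannian metric `a`. -/
def christoffel (a : Pt → Matrix (Fin 2) (Fin 2) ℝ) (k i j : Fin 2) (x : Pt) : ℝ :=
  (1/2) * ∑ l, (a x)⁻¹ k l *
    (pd (fun z => a z l j) i x + pd (fun z => a z l i) j x - pd (fun z => a z i j) l x)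

/-- Covariant derivative `c_{i|j}` of a 1-form `c` with respect to the metric `a`. -/
def covD (a : Pt → Matrix (Fin 2) (Fin 2) ℝ) (c : Pt → Fin 2 → ℝ) (i j : Fin 2) (x : Pt) : ℝ :=
  pd (fun z => c z i) j x - ∑ k, c x k * christoffel a k i j x

/-- `r_{ij}`, the symmetrized covariant derivative of the 1-form `b`. -/
def rr (a : Pt → Matrix (Fin 2) (Fin 2) ℝ) (b : Pt → Fin 2 → ℝ) (i j : Fin 2) (x : Pt) : ℝ :=
  (covD a b i j x + covD a b j i x) / 2

/-- `s_{ij}`, the antisymmetrized covariant derivative of the 1-form `b`. -/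
def so (a : Pt → Matrix (Fin 2) (Fin 2) ℝ) (b : Pt → Fin 2 → ℝ) (i j : Fin 2) (x : Pt) : ℝ :=
  (covD a b i j x - covD a b j i x) / 2

/-- `bⁱ := a^{ik} b_k`. -/
def bUp (a : Pt → Matrix (Fin 2) (Fin 2) ℝ) (b : Pt → Fin 2 → ℝ) (i : Fin 2) (x : Pt) : ℝ :=
  ∑ k, (a x)⁻¹ i k * b x k

/-- `b² := a^{ij} b_i b_j`, the squared norm of `β` with respect to `α`. -/
def bsq (a : Pt → Matrix (Fin 2) (Fin 2) ℝ) (b : Pt → Fin 2 → ℝ) (x : Pt) : ℝ :=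
  ∑ i, bUp a b i x * b x i

/-- `s_j := bⁱ s_{ij}`. -/
def sLow (a : Pt → Matrix (Fin 2) (Fin 2) ℝ) (b : Pt → Fin 2 → ℝ) (j : Fin 2) (x : Pt) : ℝ :=
  ∑ i, bUp a b i x * so a b i j x

/-- `sⁱ := a^{ik} s_k`. -/
def sUp (a : Pt → Matrix (Fin 2) (Fin 2) ℝ) (b : Pt → Fin 2 → ℝ) (i : Fin 2) (x : Pt) : ℝ :=
  ∑ k, (a x)⁻¹ i k * sLow a b k x

/-- `s₀ := s_j y^j`. -/
def sZero (a : Pt → Matrix (Fin 2) (Fin 2) ℝ) (b : Pt → Fin 2 → ℝ) (x : Pt) (y : Fin 2 → ℝ) : ℝ :=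
  ∑ j, sLow a b j x * y j

/-- The Riemannian norm `α(x,y) = √(a_{ij} yⁱ yʲ)`. -/
def alphaF (a : Pt → Matrix (Fin 2) (Fin 2) ℝ) (x : Pt) (y : Fin 2 → ℝ) : ℝ :=
  Real.sqrt (∑ i, ∑ j, a x i j * y i * y j)

/-- The 1-form `β(x,y) = b_i(x) yⁱ`. -/
def betaF (b : Pt → Fin 2 → ℝ) (x : Pt) (y : Fin 2 → ℝ) : ℝ := ∑ i, b x i * y i

/-- Fundamental tensor `g_{ij} := ½ [F²]_{yⁱyʲ}` of a Finsler metric `F`. -/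
def gMat (F : Pt → (Fin 2 → ℝ) → ℝ) (x : Pt) (y : Fin 2 → ℝ) : Matrix (Fin 2) (Fin 2) ℝ :=
  Matrix.of fun i j =>
    (1/2) * fderiv ℝ (fun y1 => fderiv ℝ (fun y2 => (F x y2)^2) y1 (Pi.single j 1)) y
      (Pi.single i 1)

/-- Spray coefficients `Gⁱ := ¼ g^{il} ([F²]_{x^k y^l} y^k − [F²]_{x^l})` of a Finsler metric. -/
def spray (F : Pt → (Fin 2 → ℝ) → ℝ) (i : Fin 2) (x : Pt) (y : Fin 2 → ℝ) : ℝ :=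
  (1/4) * ∑ l, (gMat F x y)⁻¹ i l *
    ((∑ k, (fderiv ℝ (fun x' => fderiv ℝ (fun y' => (F x' y')^2) y (Pi.single l 1)) x
        (Pi.single k 1)) * y k)
      - fderiv ℝ (fun x' => (F x' y)^2) x (Pi.single l 1))

/-- `F` is a Douglas metric on `U`: for each `x ∈ U`, `G¹y² − G²y¹` is a homogeneous
polynomial of degree 3 in `(y¹, y²)`. -/
def IsDouglasOn (F : Pt → (Fin 2 → ℝ) → ℝ) (U : Set Pt) : Prop :=
  ∀ x ∈ U, ∃ c0 c1 c2 c3 : ℝ, ∀ y : Fin 2 → ℝ, y ≠ 0 →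
    spray F 0 x y * y 1 - spray F 1 x y * y 0 =
      c0 * (y 0)^3 + c1 * (y 0)^2 * y 1 + c2 * (y 0) * (y 1)^2 + c3 * (y 1)^3

/-- The Hamel operator `F_{x^m y^l} y^m − F_{x^l}`. -/
def Hamel (F : Pt → (Fin 2 → ℝ) → ℝ) (x : Pt) (y : Fin 2 → ℝ) (l : Fin 2) : ℝ :=
  (∑ m, fderiv ℝ (fun x' => fderiv ℝ (fun y' => F x' y') y (Pi.single l 1)) x
      (Pi.single m 1) * y m)
    - fderiv ℝ (fun x' => F x' y) x (Pi.single l 1)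

/-- `F` is projectively flat on `U` (Hamel equations). -/
def ProjFlatOn (F : Pt → (Fin 2 → ℝ) → ℝ) (U : Set Pt) : Prop :=
  ∀ x ∈ U, ∀ y : Fin 2 → ℝ, y ≠ 0 → ∀ l, Hamel F x y l = 0

/-- Spray coefficients `G^i_α := ½ γ^i_{jk} y^j y^k` of the Riemannian metric `α`. -/
def sprayA (a : Pt → Matrix (Fin 2) (Fin 2) ℝ) (i : Fin 2) (x : Pt) (y : Fin 2 → ℝ) : ℝ :=
  (1/2) * ∑ j, ∑ k, christoffel a i j k x * y j * y k

/-- The projective factor `P = F_{x^m} y^m / (2F)`. -/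
def projFac (F : Pt → (Fin 2 → ℝ) → ℝ) (x : Pt) (y : Fin 2 → ℝ) : ℝ :=
  (∑ m, fderiv ℝ (fun x' => F x' y) x (Pi.single m 1) * y m) / (2 * F x y)

/-- Pullback of a Finsler metric under a coordinate map `ψ`. -/
def pullF (F : Pt → (Fin 2 → ℝ) → ℝ) (ψ : Pt → Pt) : Pt → (Fin 2 → ℝ) → ℝ :=
  fun z y => F (ψ z) (fderiv ℝ ψ z y)

/-- `ψ` is a (curvilinear) coordinate chart: a smooth injective map from the open set `V`
into `U` with everywhere invertible differential. -/
def IsCoordChart (ψ : Pt → Pt) (V U : Set Pt) : Prop :=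
  IsOpen V ∧ ContDiffOn ℝ (⊤ : ℕ∞) ψ V ∧ Set.InjOn ψ V ∧ ψ '' V ⊆ U ∧
    ∀ z ∈ V, LinearMap.det ((fderiv ℝ ψ z) : Pt →ₗ[ℝ] Pt) ≠ 0

/-- `F` is locally projectively flat on `U`: around every point there are local coordinates
in which `F` satisfies the Hamel equations. -/
def IsLocProjFlatOn (F : Pt → (Fin 2 → ℝ) → ℝ) (U : Set Pt) : Prop :=
  ∀ x ∈ U, ∃ (V : Set Pt) (ψ : Pt → Pt), IsCoordChart ψ V U ∧ x ∈ ψ '' V ∧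
    ProjFlatOn (pullF F ψ) V

/-- The integral factor of `φ`. -/
def angularIntegral (b c : ℝ) (m : ℕ) (s : ℝ) : ℝ :=
  ∫ t in (0:ℝ)..s, c * ((t^2) ^ ((m:ℝ) - 1/2)) * ((b^2 - t^2) ^ (-(3:ℝ)/2))

lemma hasDerivAt_angularIntegral {b c s : ℝ} (k : ℕ) (hs : |s| < b) :
    HasDerivAt (angularIntegral b c (k + 1))
      (c * |s| ^ (2 * k + 1) / √(b ^ 2 - s ^ 2) ^ 3) s := by
  have hb : 0 < b := (abs_nonneg s).trans_lt hs
  obtain ⟨hs1, hs2⟩ := abs_lt.mp hs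
  have hcont : ContinuousOn (fun t : ℝ =>
      c * ((t^2) ^ (((k + 1 : ℕ):ℝ) - 1/2)) * ((b^2 - t^2) ^ (-(3:ℝ)/2))) (Set.Ioo (-b) b) := by
    intro t ht
    have h1 : 0 < b ^ 2 - t ^ 2 := by nlinarith [ht.1, ht.2]
    have h2 : 0 ≤ ((k + 1 : ℕ) : ℝ) - 1 / 2 := by
      push_cast
      linarith [(Nat.cast_nonneg k : (0 : ℝ) ≤ k)]
    apply ContinuousAt.continuousWithinAt
    exact (continuousAt_const.mul
      ((continuousAt_id.pow 2).rpow_const (Or.inr h2))).mul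
      ((continuousAt_const.sub (continuousAt_id.pow 2)).rpow_const (Or.inl h1.ne'))
  have hmem : s ∈ Set.Ioo (-b) b := ⟨hs1, hs2⟩
  have hint := intervalIntegral.integral_hasDerivAt_right (a := 0)
    ((hcont.mono (Set.ordConnected_Ioo.uIcc_subset
      ⟨neg_lt_zero.mpr hb, hb⟩ hmem)).intervalIntegrable)
    (hcont.stronglyMeasurableAtFilter isOpen_Ioo s hmem)
    (hcont.continuousAt (isOpen_Ioo.mem_nhds hmem))
  have hpos : 0 < b ^ 2 - s ^ 2 := by nlinarith
  have e1 : (s ^ 2) ^ (((k + 1 : ℕ):ℝ) - 1/2) = |s| ^ (2 * k + 1) := by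
    rw [← sq_abs, ← Real.rpow_natCast, ← Real.rpow_natCast, ← Real.rpow_mul (abs_nonneg s)]
    congr 1
    push_cast
    ring
  have e2 : (b ^ 2 - s ^ 2) ^ (-(3:ℝ)/2) = (√(b ^ 2 - s ^ 2) ^ 3)⁻¹ := by
    generalize b ^ 2 - s ^ 2 = d at hpos
    rw [Real.sqrt_eq_rpow, ← Real.rpow_natCast, ← Real.rpow_mul hpos.le, ← Real.rpow_neg hpos.le]
    congr 1
    norm_num
  rw [e1, e2] at hint
  exact hint

/-- The homogeneous expression `N^k / √N · h · (1 + b Φ(s))`, `s = b w / (√N √Y)`, through which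
both `F` and its `y`-derivatives are written. -/
def radial (b c : ℝ) (k : ℕ) (N Y h w : ℝ) : ℝ :=
  N ^ k / √N * h * (1 + b * angularIntegral b c (k + 1) (b * w / (√N * √Y)))

lemma sq_sub_sq_div {b N Y p w : ℝ} (hN : 0 < N) (hY : 0 < Y) (h : w ^ 2 + p ^ 2 = N * Y) :
    b ^ 2 - (b * w / (√N * √Y)) ^ 2 = (b * |p| / (√N * √Y)) ^ 2 := by
  have hN' := Real.sqrt_pos.mpr hN
  have hY' := Real.sqrt_pos.mpr hY
  rw [div_pow, div_pow, mul_pow b |p|, sq_abs, mul_pow (√N), Real.sq_sqrt hN.le,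
    Real.sq_sqrt hY.le]
  field_simp
  linear_combination b ^ 2 * (-h)

lemma abs_arg_lt {b N Y p w : ℝ} (hb : 0 < b) (hN : 0 < N) (hY : 0 < Y) (hp : p ≠ 0)
    (h : w ^ 2 + p ^ 2 = N * Y) : |b * w / (√N * √Y)| < b := by
  have hN' := Real.sqrt_pos.mpr hN
  have hY' := Real.sqrt_pos.mpr hY
  have hpos : 0 < (b * |p| / (√N * √Y)) ^ 2 := by positivity
  apply abs_lt_of_sq_lt_sq _ hb.le
  linarith [sq_sub_sq_div (b := b) hN hY h]

lemma hasDerivAt_radial {b c t : ℝ} {k : ℕ} (hb : 0 < b) {N Y h w : ℝ → ℝ} {N' Y' h' w' p : ℝ}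
    (dN : HasDerivAt N N' t) (dY : HasDerivAt Y Y' t) (dh : HasDerivAt h h' t)
    (dw : HasDerivAt w w' t) (hN : 0 < N t) (hY : 0 < Y t) (hp : p ≠ 0)
    (hwp : w t ^ 2 + p ^ 2 = N t * Y t) :
    HasDerivAt (fun τ => radial b c k (N τ) (Y τ) (h τ) (w τ))
      (radial b c k (N t) (Y t) ((2 * k - 1) / 2 * (N' / N t) * h t + h') (w t) +
        c * b ^ (2 * k) * |w t| ^ (2 * k + 1) * √(Y t) / √(Y t) ^ (2 * k) * h t *
          (w' - w t * (N' / (2 * N t) + Y' / (2 * Y t))) / |p| ^ 3) t := by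
  have hN' := Real.sqrt_pos.mpr hN
  have hY' := Real.sqrt_pos.mpr hY
  have hp' := abs_pos.mpr hp
  have darg := ((dw.const_mul b).div ((dN.sqrt hN.ne').mul (dY.sqrt hY.ne'))
    (mul_pos hN' hY').ne')
  have dI := (hasDerivAt_angularIntegral (c := c) k (abs_arg_lt hb hN hY hp hwp)).comp t darg
  have main := (((dN.pow k).div (dN.sqrt hN.ne') hN'.ne').mul dh).mul
    ((dI.const_mul b).const_add 1)
  refine main.congr_deriv ?_
  simp only [Pi.mul_apply, Pi.div_apply, Function.comp_apply, Pi.pow_apply]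
  rw [sq_sub_sq_div hN hY hwp, Real.sqrt_sq (by positivity), abs_div, abs_mul, abs_of_pos hb,
    abs_of_pos (mul_pos hN' hY'), radial]
  have hNk : (k : ℝ) * N t ^ (k - 1) = k * N t ^ k / N t := by
    rcases k with _ | k
    · simp
    · rw [pow_succ]
      field_simp
      simp
  rw [hNk]
  obtain ⟨q, hq⟩ : ∃ q, q = √(N t) := ⟨_, rfl⟩
  obtain ⟨z, hz⟩ : ∃ z, z = √(Y t) := ⟨_, rfl⟩
  have hNq : N t = q ^ 2 := by rw [hq, Real.sq_sqrt hN.le]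
  have hYz : Y t = z ^ 2 := by rw [hz, Real.sq_sqrt hY.le]
  rw [← hq, ← hz]
  rw [← hq] at hN'
  rw [← hz] at hY'
  rw [hNq, hYz]
  generalize angularIntegral b c (k + 1) (b * w t / (q * z)) = I
  simp only [div_pow, mul_pow, ← pow_mul, pow_succ _ (2 * k)]
  have := pow_pos hN' (2 * k)
  have := pow_pos hY' (2 * k)
  field_simp

lemma differentiableAt_div_of_ne_zero {E : Type*} [NormedAddCommGroup E] [NormedSpace ℝ E]
    {f g : E → ℝ} {e : E} (hf : DifferentiableAt ℝ f e) (hg : DifferentiableAt ℝ g e)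
    (h : g e ≠ 0) : DifferentiableAt ℝ (fun z => f z / g z) e := by
  simpa only [div_eq_mul_inv] using hf.fun_mul (hg.fun_inv h)

lemma differentiableAt_radial {E : Type*} [NormedAddCommGroup E] [NormedSpace ℝ E]
    {b c : ℝ} {k : ℕ} (hb : 0 < b) {N Y h w : E → ℝ} {p : ℝ} {e : E}
    (dN : DifferentiableAt ℝ N e) (dY : DifferentiableAt ℝ Y e) (dh : DifferentiableAt ℝ h e)
    (dw : DifferentiableAt ℝ w e) (hN : 0 < N e) (hY : 0 < Y e) (hp : p ≠ 0)
    (hwp : w e ^ 2 + p ^ 2 = N e * Y e) :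
    DifferentiableAt ℝ (fun z => radial b c k (N z) (Y z) (h z) (w z)) e := by
  have hN' := Real.sqrt_pos.mpr hN
  have hY' := Real.sqrt_pos.mpr hY
  have dden : DifferentiableAt ℝ (fun z => √(N z) * √(Y z)) e :=
    (dN.sqrt hN.ne').fun_mul (dY.sqrt hY.ne')
  have darg := differentiableAt_div_of_ne_zero (dw.const_mul b) dden (mul_pos hN' hY').ne'
  have dI := (hasDerivAt_angularIntegral (c := c) k
    (abs_arg_lt hb hN hY hp hwp)).differentiableAt.comp e darg
  exact ((differentiableAt_div_of_ne_zero (dN.pow k) (dN.sqrt hN.ne') hN'.ne').mul dh).mul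
    ((dI.const_mul b).const_add 1)

lemma differentiableAt_abs_pow {k : ℕ} {t : ℝ} (h : k ≠ 0 ∨ t ≠ 0) :
    DifferentiableAt ℝ (fun s : ℝ => |s| ^ (2 * k + 1)) t := by
  rcases h with hk | ht
  · have h1 : (1 : ℝ) < ((2 * k + 1 : ℕ) : ℝ) := by
      exact_mod_cast (by omega : 1 < 2 * k + 1)
    simpa only [Real.rpow_natCast] using (hasDerivAt_abs_rpow t h1).differentiableAt
  · exact (differentiableAt_abs ht).pow _

/-- Squared Euclidean length. -/
def normSqr (x : Pt) : ℝ := x 0 ^ 2 + x 1 ^ 2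

/-- Euclidean inner product. -/
def dotP (x y : Pt) : ℝ := x 0 * y 0 + x 1 * y 1

/-- Signed area `x¹ y⁰ - x⁰ y¹`. -/
def wedgeP (x y : Pt) : ℝ := x 1 * y 0 - x 0 * y 1

/-- Rotation by a right angle. -/
def rotP (y : Pt) : Pt := ![y 1, -y 0]

lemma wedgeP_sq_add_dotP_sq (x y : Pt) :
    wedgeP x y ^ 2 + dotP x y ^ 2 = normSqr x * normSqr y := by
  simp only [wedgeP, dotP, normSqr]
  ring

lemma normSqr_pos {x : Pt} (hx : x ≠ 0) : 0 < normSqr x := by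
  have h : x 0 ≠ 0 ∨ x 1 ≠ 0 := by
    by_contra! h
    exact hx (by ext i; fin_cases i <;> simp [h])
  unfold normSqr
  rcases h with h | h <;> positivity

lemma differentiable_normSqr : Differentiable ℝ normSqr := by
  unfold normSqr
  fun_prop

lemma differentiable_dotP_left (y : Pt) : Differentiable ℝ (fun x => dotP x y) := by
  unfold dotP
  fun_prop

lemma differentiable_dotP_right (x : Pt) : Differentiable ℝ (dotP x) := by
  unfold dotP
  fun_prop

lemma differentiable_wedgeP_left (y : Pt) : Differentiable ℝ (fun x => wedgeP x y) := by
  unfold wedgeP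
  fun_prop

lemma differentiable_wedgeP_right (x : Pt) : Differentiable ℝ (wedgeP x) := by
  unfold wedgeP
  fun_prop

lemma hasDerivAt_line_apply (x v : Pt) (i : Fin 2) :
    HasDerivAt (fun t : ℝ => (x + t • v) i) (v i) 0 := by
  simpa using ((hasDerivAt_id (0 : ℝ)).mul_const (v i)).const_add (x i)

lemma hasDerivAt_line_normSqr (x v : Pt) :
    HasDerivAt (fun t : ℝ => normSqr (x + t • v)) (2 * dotP x v) 0 := by
  refine (((hasDerivAt_line_apply x v 0).pow 2).add
    ((hasDerivAt_line_apply x v 1).pow 2)).congr_deriv ?_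
  simp [dotP]
  ring

lemma hasDerivAt_line_dotP_left (x v y : Pt) :
    HasDerivAt (fun t : ℝ => dotP (x + t • v) y) (dotP v y) 0 :=
  ((hasDerivAt_line_apply x v 0).mul_const (y 0)).add
    ((hasDerivAt_line_apply x v 1).mul_const (y 1))

lemma hasDerivAt_line_dotP_right (x y v : Pt) :
    HasDerivAt (fun t : ℝ => dotP x (y + t • v)) (dotP x v) 0 :=
  ((hasDerivAt_line_apply y v 0).const_mul (x 0)).add
    ((hasDerivAt_line_apply y v 1).const_mul (x 1))

lemma hasDerivAt_line_wedgeP_left (x v y : Pt) :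
    HasDerivAt (fun t : ℝ => wedgeP (x + t • v) y) (wedgeP v y) 0 :=
  ((hasDerivAt_line_apply x v 1).mul_const (y 0)).sub
    ((hasDerivAt_line_apply x v 0).mul_const (y 1))

lemma hasDerivAt_line_wedgeP_right (x y v : Pt) :
    HasDerivAt (fun t : ℝ => wedgeP x (y + t • v)) (wedgeP x v) 0 :=
  ((hasDerivAt_line_apply y v 0).const_mul (x 1)).sub
    ((hasDerivAt_line_apply y v 1).const_mul (x 0))

lemma abs_cube_eq_of_sign {ε p : ℝ} (hε : ε * p = |p|) : |p| ^ 3 = ε * p * p ^ 2 := by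
  rw [hε, ← sq_abs p]
  ring

lemma sign_ne_zero_of_mul_eq_abs {ε p : ℝ} (hp : p ≠ 0) (hε : ε * p = |p|) : ε ≠ 0 :=
  left_ne_zero_of_mul (hε ▸ abs_ne_zero.mpr hp)

/-- The metric of the example on a component of `{⟨x, y⟩ ≠ 0}`, with `ε` the sign of `⟨x, y⟩`. -/
def signedMetric (b c : ℝ) (k : ℕ) (ε : ℝ) (x y : Pt) : ℝ :=
  ε * radial b c k (normSqr x) (normSqr y) (dotP x y) (wedgeP x y)

/-- The partial derivative of `signedMetric` with respect to `y l`. -/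
def signedMetricGrad (b c : ℝ) (k : ℕ) (ε : ℝ) (l : Fin 2) (x y : Pt) : ℝ :=
  ε * radial b c k (normSqr x) (normSqr y) (x l) (wedgeP x y) +
    c * b ^ (2 * k) * √(normSqr y) / √(normSqr y) ^ (2 * k) / normSqr y * rotP y l *
      (|wedgeP x y| ^ (2 * k + 1) / dotP x y)

lemma fderiv_eq_of_hasDerivAt_line {f : Pt → ℝ} {x v : Pt} {f' : ℝ}
    (hf : DifferentiableAt ℝ f x) (h : HasDerivAt (fun t : ℝ => f (x + t • v)) f' 0) :
    fderiv ℝ f x v = f' :=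
  (hf.hasFDerivAt.hasLineDerivAt v).unique h

section Metric

variable {b c ε : ℝ} {k : ℕ} {x y : Pt}

lemma fderiv_signedMetric_right (hb : 0 < b) (hx : x ≠ 0) (hy : y ≠ 0) (hp : dotP x y ≠ 0)
    (hε : ε * dotP x y = |dotP x y|) (l : Fin 2) :
    fderiv ℝ (fun y' => signedMetric b c k ε x y') y (Pi.single l 1) =
      signedMetricGrad b c k ε l x y := by
  have hN := normSqr_pos hx
  have hY := normSqr_pos hy
  have hwp := wedgeP_sq_add_dotP_sq x y
  apply fderiv_eq_of_hasDerivAt_line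
  · exact (differentiableAt_radial hb (differentiableAt_const _) (differentiable_normSqr y)
      (differentiable_dotP_right x y) (differentiable_wedgeP_right x y) hN hY hp hwp).const_mul ε
  · have h := (hasDerivAt_radial (c := c) (k := k) hb (hasDerivAt_const (0 : ℝ) (normSqr x))
      (hasDerivAt_line_normSqr y (Pi.single l 1)) (hasDerivAt_line_dotP_right x y (Pi.single l 1))
      (hasDerivAt_line_wedgeP_right x y (Pi.single l 1)) hN (by simpa using hY) hp
      (by simpa using hwp)).const_mul ε
    refine h.congr_deriv ?_
    have e1 : dotP x (Pi.single l 1) = x l := by fin_cases l <;> simp [dotP]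
    have e2 : dotP y (Pi.single l 1) = y l := by fin_cases l <;> simp [dotP]
    have e3 : wedgeP x (Pi.single l 1) * normSqr y - wedgeP x y * y l = dotP x y * rotP y l := by
      fin_cases l <;> simp [wedgeP, dotP, normSqr, rotP] <;> ring
    simp only [zero_smul, add_zero, zero_div, mul_zero, zero_mul, zero_add, e1, e2,
      signedMetricGrad, mul_add]
    congr 1
    have e4 : wedgeP x (Pi.single l 1) - wedgeP x y * (2 * y l / (2 * normSqr y)) =
        dotP x y * rotP y l / normSqr y := by
      rw [← e3]
      field_simp
    rw [e4]
    have e5 := abs_cube_eq_of_sign hε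
    have hε0 := sign_ne_zero_of_mul_eq_abs hp hε
    have hY' := Real.sqrt_pos.mpr hY
    rw [e5]
    field_simp

lemma fderiv_signedMetric_left (hb : 0 < b) (hx : x ≠ 0) (hy : y ≠ 0) (hp : dotP x y ≠ 0)
    (hε : ε * dotP x y = |dotP x y|) (l : Fin 2) :
    fderiv ℝ (fun x' => signedMetric b c k ε x' y) x (Pi.single l 1) =
      ε * radial b c k (normSqr x) (normSqr y)
        ((2 * k - 1) * x l / normSqr x * dotP x y + y l) (wedgeP x y) -
      c * b ^ (2 * k) * √(normSqr y) / √(normSqr y) ^ (2 * k) * |wedgeP x y| ^ (2 * k + 1) *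
        rotP x l / (normSqr x * dotP x y) := by
  have hN := normSqr_pos hx
  have hY := normSqr_pos hy
  have hwp := wedgeP_sq_add_dotP_sq x y
  apply fderiv_eq_of_hasDerivAt_line
  · exact (differentiableAt_radial hb (differentiable_normSqr x) (differentiableAt_const _)
      (differentiable_dotP_left y x) (differentiable_wedgeP_left y x) hN hY hp hwp).const_mul ε
  · have h := (hasDerivAt_radial (c := c) (k := k) hb
      (hasDerivAt_line_normSqr x (Pi.single l 1)) (hasDerivAt_const (0 : ℝ) (normSqr y))
      (hasDerivAt_line_dotP_left x (Pi.single l 1) y)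
      (hasDerivAt_line_wedgeP_left x (Pi.single l 1) y) (by simpa using hN) hY hp
      (by simpa using hwp)).const_mul ε
    refine h.congr_deriv ?_
    have e1 : dotP (Pi.single l 1) y = y l := by fin_cases l <;> simp [dotP]
    have e2 : dotP x (Pi.single l 1) = x l := by fin_cases l <;> simp [dotP]
    have e3 : wedgeP (Pi.single l 1) y * normSqr x - wedgeP x y * x l =
        -(dotP x y * rotP x l) := by
      fin_cases l <;> simp [wedgeP, dotP, normSqr, rotP] <;> ring
    simp only [zero_smul, add_zero, zero_div, e1, e2, mul_add]
    have e4 : wedgeP (Pi.single l 1) y - wedgeP x y * (2 * x l / (2 * normSqr x)) =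
        -(dotP x y * rotP x l) / normSqr x := by
      rw [← e3]
      field_simp
    have e5 := abs_cube_eq_of_sign hε
    have hε0 := sign_ne_zero_of_mul_eq_abs hp hε
    have hY' := Real.sqrt_pos.mpr hY
    have e6 : (2 * (k : ℝ) - 1) / 2 * (2 * x l / normSqr x) = (2 * k - 1) * x l / normSqr x := by
      field_simp
    rw [e4, e5, e6, sub_eq_add_neg]
    congr 1
    field_simp

lemma hasDerivAt_line_signedMetricGrad (hb : 0 < b) (hx : x ≠ 0) (hy : y ≠ 0)
    (hp : dotP x y ≠ 0) (hε : ε * dotP x y = |dotP x y|) (l : Fin 2) :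
    HasDerivAt (fun t : ℝ => signedMetricGrad b c k ε l (x + t • y) y)
      (fderiv ℝ (fun x' => signedMetric b c k ε x' y) x (Pi.single l 1)) 0 := by
  have hN := normSqr_pos hx
  have hY := normSqr_pos hy
  have hwp := wedgeP_sq_add_dotP_sq x y
  have hw : ∀ t : ℝ, wedgeP (x + t • y) y = wedgeP x y := fun t => by
    simp [wedgeP]
    ring
  simp only [signedMetricGrad, hw]
  have h := (hasDerivAt_radial (c := c) (k := k) hb
      (hasDerivAt_line_normSqr x y) (hasDerivAt_const (0 : ℝ) (normSqr y))
      (hasDerivAt_line_apply x y l) (hasDerivAt_const (0 : ℝ) (wedgeP x y)) (by simpa using hN)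
      hY hp (by simpa using hwp)).const_mul ε
  have h2 := ((hasDerivAt_const (0 : ℝ) (|wedgeP x y| ^ (2 * k + 1))).div
    (hasDerivAt_line_dotP_left x y y) (by simpa using hp)).const_mul
    (c * b ^ (2 * k) * √(normSqr y) / √(normSqr y) ^ (2 * k) / normSqr y * rotP y l)
  refine (h.add h2).congr_deriv ?_
  rw [fderiv_signedMetric_left hb hx hy hp hε]
  have e3 : wedgeP x y * x l + normSqr x * rotP y l = dotP x y * rotP x l := by
    fin_cases l <;> simp [wedgeP, dotP, normSqr, rotP] <;> ring
  have e5 := abs_cube_eq_of_sign hε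
  have e6 : (2 * (k : ℝ) - 1) / 2 * (2 * dotP x y / normSqr x) * x l + y l =
      (2 * k - 1) * x l / normSqr x * dotP x y + y l := by
    field_simp
  have e7 : dotP y y = normSqr y := by simp only [dotP, normSqr]; ring
  have hε0 := sign_ne_zero_of_mul_eq_abs hp hε
  have hY' := Real.sqrt_pos.mpr hY
  simp only [zero_smul, add_zero, zero_div, mul_add ε, e5, e6, e7]
  rw [add_assoc (ε * _), sub_eq_add_neg (ε * _)]
  congr 1
  field_simp
  linear_combination (-(c * |wedgeP x y| ^ (2 * k + 1) * dotP x y * normSqr y)) * e3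

lemma differentiableAt_signedMetricGrad (hb : 0 < b) (hx : x ≠ 0) (hy : y ≠ 0)
    (hp : dotP x y ≠ 0) (h : k ≠ 0 ∨ wedgeP x y ≠ 0) (l : Fin 2) :
    DifferentiableAt ℝ (fun x' => signedMetricGrad b c k ε l x' y) x := by
  have hrad : DifferentiableAt ℝ
      (fun x' => radial b c k (normSqr x') (normSqr y) (x' l) (wedgeP x' y)) x :=
    differentiableAt_radial hb (differentiable_normSqr x) (differentiableAt_const _)
      (by fun_prop) (differentiable_wedgeP_left y x) (normSqr_pos hx) (normSqr_pos hy) hp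
      (wedgeP_sq_add_dotP_sq x y)
  have hpow : DifferentiableAt ℝ (fun x' => |wedgeP x' y| ^ (2 * k + 1)) x :=
    DifferentiableAt.fun_comp' x (differentiableAt_abs_pow h) (differentiable_wedgeP_left y x)
  exact (hrad.const_mul ε).add
    ((differentiableAt_div_of_ne_zero hpow (differentiable_dotP_left y x) hp).const_mul _)

/-- For `k = 0` the metric is stationary in `x` where `x ∥ y`. -/
lemma fderiv_signedMetric_left_eq_zero (hb : 0 < b) (hx : x ≠ 0) (hy : y ≠ 0)
    (hp : dotP x y ≠ 0) (hε : ε * dotP x y = |dotP x y|) (hw : wedgeP x y = 0) (l : Fin 2) :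
    fderiv ℝ (fun x' => signedMetric b c 0 ε x' y) x (Pi.single l 1) = 0 := by
  have hN := normSqr_pos hx
  have e : (2 * ((0 : ℕ) : ℝ) - 1) * x l / normSqr x * dotP x y + y l = 0 := by
    have h : x l * dotP x y = y l * normSqr x := by
      simp only [wedgeP] at hw
      fin_cases l
      · simp [dotP, normSqr]
        linear_combination (-x 1) * hw
      · simp [dotP, normSqr]
        linear_combination (x 0) * hw
    push_cast
    field_simp
    linear_combination -h
  rw [fderiv_signedMetric_left hb hx hy hp hε, e, hw]
  simp [radial]

lemma hamel_eq_zero_of_eq_signedMetric {F : Pt → Pt → ℝ} (hb : 0 < b) (hx : x ≠ 0) (hy : y ≠ 0)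
    (hp : dotP x y ≠ 0) (hε : ε * dotP x y = |dotP x y|)
    (hF : ∀ x' y' : Pt, x' ≠ 0 → y' ≠ 0 → 0 < ε * dotP x' y' →
      F x' y' = signedMetric b c k ε x' y')
    (hε1 : |ε| = 1) (l : Fin 2) : Hamel F x y l = 0 := by
  have hpos : 0 < ε * dotP x y := hε ▸ abs_pos.mpr hp
  have near_x : ∀ᶠ x' in nhds x, x' ≠ 0 ∧ 0 < ε * dotP x' y :=
    (isOpen_ne.eventually_mem hx).and
      ((((differentiable_dotP_left y).continuous.const_mul ε).tendsto x).eventually_const_lt hpos)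
  have near_y : ∀ x' : Pt, 0 < ε * dotP x' y → ∀ᶠ y' in nhds y, y' ≠ 0 ∧ 0 < ε * dotP x' y' :=
    fun x' h => (isOpen_ne.eventually_mem hy).and
      ((((differentiable_dotP_right x').continuous.const_mul ε).tendsto y).eventually_const_lt h)
  have grad_eq : (fun x' => fderiv ℝ (fun y' => F x' y') y (Pi.single l 1)) =ᶠ[nhds x]
      fun x' => signedMetricGrad b c k ε l x' y := by
    filter_upwards [near_x] with x' hx'
    have hp' : dotP x' y ≠ 0 := right_ne_zero_of_mul hx'.2.ne'
    have heq : (fun y' => F x' y') =ᶠ[nhds y] fun y' => signedMetric b c k ε x' y' := by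
      filter_upwards [near_y x' hx'.2] with y' hy' using hF x' y' hx'.1 hy'.1 hy'.2
    have hε' : ε * dotP x' y = |dotP x' y| := by
      rw [← abs_of_pos hx'.2, abs_mul, hε1, one_mul]
    rw [heq.fderiv_eq, fderiv_signedMetric_right hb hx'.1 hy hp' hε']
  have left_eq : (fun x' => F x' y) =ᶠ[nhds x] fun x' => signedMetric b c k ε x' y := by
    filter_upwards [near_x] with x' hx' using hF x' y hx'.1 hy hx'.2
  have hsum : ∀ D : Pt →L[ℝ] ℝ, ∑ i, D (Pi.single i 1) * y i = D y := fun D => by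
    conv_rhs => rw [pi_eq_sum_univ' y, map_sum]
    refine Finset.sum_congr rfl fun i _ => ?_
    rw [map_smul, smul_eq_mul, mul_comm]
  unfold Hamel
  rw [hsum, grad_eq.fderiv_eq, left_eq.fderiv_eq, sub_eq_zero]
  by_cases hd : DifferentiableAt ℝ (fun x' => signedMetricGrad b c k ε l x' y) x
  · exact fderiv_eq_of_hasDerivAt_line hd (hasDerivAt_line_signedMetricGrad hb hx hy hp hε l)
  · -- the `y`-gradient can fail to be differentiable only if `k = 0` and `x ∥ y`
    have hkw : k = 0 ∧ wedgeP x y = 0 := by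
      by_contra hne
      exact hd (differentiableAt_signedMetricGrad hb hx hy hp (by tauto) l)
    obtain ⟨rfl, hw⟩ := hkw
    rw [fderiv_zero_of_not_differentiableAt hd,
      fderiv_signedMetric_left_eq_zero hb hx hy hp hε hw]
    rfl

lemma exp_mul_log_eq_pow {N : ℝ} (hN : 0 < N) (k : ℕ) :
    Real.exp ((((k + 1 : ℕ) : ℝ) - 1) * Real.log N) = N ^ k := by
  push_cast
  rw [add_sub_cancel_right, mul_comm, ← Real.rpow_def_of_pos hN, Real.rpow_natCast]

lemma alpha_mul_phi_eq_signedMetric (hb : 0 < b) (hx : x ≠ 0) (hy : y ≠ 0)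
    (hε : ε * dotP x y = |dotP x y|) :
    normSqr x ^ k * √(normSqr y) *
      (√(b ^ 2 - (b * wedgeP x y / (√(normSqr x) * √(normSqr y))) ^ 2) / b +
        √(b ^ 2 - (b * wedgeP x y / (√(normSqr x) * √(normSqr y))) ^ 2) *
          angularIntegral b c (k + 1) (b * wedgeP x y / (√(normSqr x) * √(normSqr y)))) =
      signedMetric b c k ε x y := by
  have hN := normSqr_pos hx
  have hY := normSqr_pos hy
  have hN' := Real.sqrt_pos.mpr hN
  have hY' := Real.sqrt_pos.mpr hY
  rw [sq_sub_sq_div hN hY (wedgeP_sq_add_dotP_sq x y), Real.sqrt_sq (by positivity),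
    signedMetric, radial, ← hε]
  field_simp

lemma dotP_ne_zero_of_abs_lt {E : ℝ} (hE : 0 < E) (hb : 0 < b) (hx : x ≠ 0)
    (h : |E * b * wedgeP x y / √(normSqr x)| < b * (E * √(normSqr y))) : dotP x y ≠ 0 := by
  intro h0
  have hN' := Real.sqrt_pos.mpr (normSqr_pos hx)
  have hwp := wedgeP_sq_add_dotP_sq x y
  have hw : |wedgeP x y| = √(normSqr x) * √(normSqr y) := by
    rw [← Real.sqrt_mul (normSqr_pos hx).le, ← hwp, h0, ← Real.sqrt_sq_eq_abs]
    simp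
  rw [abs_div, abs_mul, abs_of_pos (mul_pos hE hb), abs_of_pos hN', hw] at h
  refine absurd h (not_lt.mpr (le_of_eq ?_))
  field_simp

end Metric

lemma pd_exp_mul_div_sqrt_one (b p : ℝ) :
    pd (fun z => Real.exp (p * Real.log ((z 0)^2 + (z 1)^2)) * b *
      z 1 / Real.sqrt ((z 0)^2 + (z 1)^2)) 1 ![1, 0] = b := by
  unfold pd
  have hN : (0 : ℝ) < normSqr ![1, 0] := by simp [normSqr]
  have hs := (Real.sqrt_pos.mpr hN).ne'
  apply fderiv_eq_of_hasDerivAt_line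
  · have d := differentiable_normSqr ![1, 0]
    exact differentiableAt_div_of_ne_zero (((((d.log hN.ne').const_mul p).exp).mul_const b).fun_mul
      (by fun_prop : DifferentiableAt ℝ (fun z : Pt => z 1) ![1, 0])) (d.sqrt hN.ne') hs
  · have hN0 : normSqr (![1, 0] + (0 : ℝ) • Pi.single 1 1) ≠ 0 := by simp [normSqr]
    have d := hasDerivAt_line_normSqr ![1, 0] (Pi.single 1 1)
    refine (((((d.log hN0).const_mul p).exp.mul_const b).fun_mul
      (hasDerivAt_line_apply ![1, 0] (Pi.single 1 1) 1)).fun_div (d.sqrt hN0)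
      (by simp [normSqr])).congr_deriv ?_
    simp [normSqr, dotP]

lemma pd_neg_exp_mul_div_sqrt_zero (b p : ℝ) :
    pd (fun z => -(Real.exp (p * Real.log ((z 0)^2 + (z 1)^2)) * b *
      z 0 / Real.sqrt ((z 0)^2 + (z 1)^2))) 0 ![1, 0] = -(2 * p * b) := by
  unfold pd
  have hN : (0 : ℝ) < normSqr ![1, 0] := by simp [normSqr]
  have hs := (Real.sqrt_pos.mpr hN).ne'
  apply fderiv_eq_of_hasDerivAt_line
  · have d := differentiable_normSqr ![1, 0]
    exact (differentiableAt_div_of_ne_zero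
      (((((d.log hN.ne').const_mul p).exp).mul_const b).fun_mul
        (by fun_prop : DifferentiableAt ℝ (fun z : Pt => z 0) ![1, 0]))
      (d.sqrt hN.ne') hs).fun_neg
  · have hN0 : normSqr (![1, 0] + (0 : ℝ) • Pi.single 0 1) ≠ 0 := by simp [normSqr]
    have d := hasDerivAt_line_normSqr ![1, 0] (Pi.single 0 1)
    refine (((((d.log hN0).const_mul p).exp.mul_const b).fun_mul
      (hasDerivAt_line_apply ![1, 0] (Pi.single 0 1) 0)).fun_div (d.sqrt hN0)
      (by simp [normSqr])).fun_neg.congr_deriv ?_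
    simp [normSqr, dotP]
    left
    ring



/-- Example 6.4 of the paper: a projectively flat singular
(α,β)-metric with β not closed. -/
theorem stmt13 (bc c : ℝ) (hbc : 0 < bc) (m : ℕ) (hm : 1 ≤ m) :
    (∀ x : Pt, x ≠ 0 → ∀ y : Fin 2 → ℝ, y ≠ 0 →
      |Real.exp (((m:ℝ) - 1) * Real.log ((x 0)^2 + (x 1)^2)) * bc *
          (x 1 * y 0 - x 0 * y 1) / Real.sqrt ((x 0)^2 + (x 1)^2)| <
        bc * (Real.exp (((m:ℝ) - 1) * Real.log ((x 0)^2 + (x 1)^2)) *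
          Real.sqrt ((y 0)^2 + (y 1)^2)) →
      ∀ l : Fin 2,
        Hamel (fun x y =>
          (Real.exp (((m:ℝ) - 1) * Real.log ((x 0)^2 + (x 1)^2)) *
              Real.sqrt ((y 0)^2 + (y 1)^2)) *
            (fun s => Real.sqrt (bc^2 - s^2) / bc + Real.sqrt (bc^2 - s^2) *
                ∫ t in (0:ℝ)..s, c * ((t^2) ^ ((m:ℝ) - 1/2)) * ((bc^2 - t^2) ^ (-(3:ℝ)/2)))
              ((Real.exp (((m:ℝ) - 1) * Real.log ((x 0)^2 + (x 1)^2)) * bc *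
                  (x 1 * y 0 - x 0 * y 1) / Real.sqrt ((x 0)^2 + (x 1)^2)) /
                (Real.exp (((m:ℝ) - 1) * Real.log ((x 0)^2 + (x 1)^2)) *
                  Real.sqrt ((y 0)^2 + (y 1)^2))))
          x y l = 0) ∧
    ¬ (∀ x : Pt, x ≠ 0 →
      pd (fun z => Real.exp (((m:ℝ) - 1) * Real.log ((z 0)^2 + (z 1)^2)) * bc *
          z 1 / Real.sqrt ((z 0)^2 + (z 1)^2)) 1 x =
      pd (fun z => -(Real.exp (((m:ℝ) - 1) * Real.log ((z 0)^2 + (z 1)^2)) * bc *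
          z 0 / Real.sqrt ((z 0)^2 + (z 1)^2))) 0 x) := by
  obtain ⟨k, rfl⟩ : ∃ k, m = k + 1 := ⟨m - 1, by omega⟩
  refine ⟨fun x hx y hy hlt l => ?_, fun hclosed => ?_⟩
  · have hp : dotP x y ≠ 0 := dotP_ne_zero_of_abs_lt (Real.exp_pos _) hbc hx hlt
    obtain ⟨ε, hε1, hε⟩ : ∃ ε : ℝ, |ε| = 1 ∧ ε * dotP x y = |dotP x y| := by
      rcases le_total 0 (dotP x y) with h | h
      · exact ⟨1, abs_one, by rw [abs_of_nonneg h, one_mul]⟩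
      · exact ⟨-1, by simp, by rw [abs_of_nonpos h, neg_one_mul]⟩
    refine hamel_eq_zero_of_eq_signedMetric (c := c) (k := k) hbc hx hy hp hε
      (fun x' y' hx' hy' hpos => ?_) hε1 l
    have hN := normSqr_pos hx'
    have hε' : ε * dotP x' y' = |dotP x' y'| := by
      rw [← abs_of_pos hpos, abs_mul, hε1, one_mul]
    rw [← alpha_mul_phi_eq_signedMetric hbc hx' hy' hε']
    have hs : normSqr x' ^ k * bc * wedgeP x' y' / √(normSqr x') /
        (normSqr x' ^ k * √(normSqr y')) =
        bc * wedgeP x' y' / (√(normSqr x') * √(normSqr y')) := by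
      have hN' := Real.sqrt_pos.mpr hN
      have hY' := Real.sqrt_pos.mpr (normSqr_pos hy')
      field_simp
    rw [← hs, ← exp_mul_log_eq_pow hN]
    rfl
  · have h := hclosed ![1, 0] (fun h0 => by simpa using congrFun h0 0)
    rw [pd_exp_mul_div_sqrt_one, pd_neg_exp_mul_div_sqrt_zero] at h
    push_cast at h
    have := mul_nonneg (Nat.cast_nonneg (α := ℝ) k) hbc.le
    nlinarith

end
end

section
/- Let k, c be real constants and set k₁ := 2c − k, k₂ := k(c + k), k₃ := −3c − k. Then the function φ(s) = √(1−ks²) + cs²/√(1−ks²) satisfies the ODE (1 + (k₁+k₃)s² + k₂s⁴)·φ''(s) = (k₁ + k₂s²)·(φ(s) − sφ'(s)) for all s with 1 − ks² > 0. Moreover these constants satisfy k₂ = (2k₁+3k₃)(3k₁+2k₃)/25. -/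
noncomputable section

theorem hasDerivAt_sqrt_one_sub_mul_sq (k : ℝ) {s : ℝ} (hs : 0 < 1 - k*s^2) :
    HasDerivAt (fun t => Real.sqrt (1 - k*t^2)) (-(k*s) / Real.sqrt (1 - k*s^2)) s := by
  have h := ((((hasDerivAt_id s).pow 2).const_mul k).const_sub 1).sqrt hs.ne'
  refine h.congr_deriv ?_
  have hr : Real.sqrt (1 - k*s^2) ≠ 0 := (Real.sqrt_pos.2 hs).ne'
  simp
  field_simp

theorem hasDerivAt_sqrt_add_div_sqrt (k c : ℝ) {s : ℝ} (hs : 0 < 1 - k*s^2) :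
    HasDerivAt (fun t => Real.sqrt (1 - k*t^2) + c*t^2 / Real.sqrt (1 - k*t^2))
      ((2*c - k)*s / Real.sqrt (1 - k*s^2) + c*k*s^3 / Real.sqrt (1 - k*s^2)^3) s := by
  have hr : Real.sqrt (1 - k*s^2) ≠ 0 := (Real.sqrt_pos.2 hs).ne'
  have hd := hasDerivAt_sqrt_one_sub_mul_sq k hs
  refine (hd.add (((hasDerivAt_pow 2 s).const_mul c).div hd hr)).congr_deriv ?_
  field_simp
  push_cast
  ring

theorem hasDerivAt_deriv_sqrt_add_div_sqrt (k c : ℝ) {s : ℝ} (hs : 0 < 1 - k*s^2) :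
    HasDerivAt (deriv (fun t => Real.sqrt (1 - k*t^2) + c*t^2 / Real.sqrt (1 - k*t^2)))
      (((2*c - k) + k*(c + k)*s^2) / Real.sqrt (1 - k*s^2)^5) s := by
  have hr : Real.sqrt (1 - k*s^2) ≠ 0 := (Real.sqrt_pos.2 hs).ne'
  have hsq : Real.sqrt (1 - k*s^2)^2 = 1 - k*s^2 := Real.sq_sqrt hs.le
  have hd := hasDerivAt_sqrt_one_sub_mul_sq k hs
  have hopen : ∀ᶠ t in nhds s, 0 < 1 - k*t^2 :=
    (by fun_prop : Continuous fun t : ℝ => 1 - k*t^2).continuousAt.eventually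
      (lt_mem_nhds hs)
  have h := (((hasDerivAt_id s).const_mul (2*c - k)).div hd hr).add
    (((hasDerivAt_pow 3 s).const_mul (c*k)).div (hd.pow 3) (pow_ne_zero 3 hr))
  refine (h.congr_of_eventuallyEq ?_).congr_deriv ?_
  · filter_upwards [hopen] with t ht
    exact (hasDerivAt_sqrt_add_div_sqrt k c ht).deriv
  · simp only [id, Pi.pow_apply]
    generalize Real.sqrt (1 - k*s^2) = r at *
    field_simp
    push_cast
    have h4 : r^4 = (1 - k*s^2)^2 := by rw [← hsq]; ring
    have h6 : r^6 = (1 - k*s^2)^3 := by rw [← hsq]; ring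
    ring_nf
    simp only [h6, h4, hsq]
    ring

/-- with `k₁ = 2c − k`, `k₂ = k(c+k)`, `k₃ = −3c − k`, the function
`φ(s) = √(1−ks²) + cs²/√(1−ks²)` solves the basic ODE, and
`k₂ = (2k₁+3k₃)(3k₁+2k₃)/25`. -/
theorem stmt15 (k c : ℝ) :
    (∀ s : ℝ, 1 - k*s^2 > 0 →
      (1 + ((2*c - k) + (-3*c - k))*s^2 + (k*(c + k))*s^4) *
        deriv (deriv (fun t => Real.sqrt (1 - k*t^2) + c*t^2 / Real.sqrt (1 - k*t^2))) s
      = ((2*c - k) + (k*(c + k))*s^2) *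
        ((Real.sqrt (1 - k*s^2) + c*s^2 / Real.sqrt (1 - k*s^2))
          - s * deriv (fun t => Real.sqrt (1 - k*t^2) + c*t^2 / Real.sqrt (1 - k*t^2)) s)) ∧
    k*(c + k) = (2*(2*c - k) + 3*(-3*c - k)) * (3*(2*c - k) + 2*(-3*c - k)) / 25 := by
  refine ⟨fun s hs => ?_, by ring⟩
  have hr : Real.sqrt (1 - k*s^2) ≠ 0 := (Real.sqrt_pos.2 hs).ne'
  have hsq : Real.sqrt (1 - k*s^2)^2 = 1 - k*s^2 := Real.sq_sqrt hs.le
  rw [(hasDerivAt_deriv_sqrt_add_div_sqrt k c hs).deriv,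
    (hasDerivAt_sqrt_add_div_sqrt k c hs).deriv]
  generalize Real.sqrt (1 - k*s^2) = r at *
  have hcoef : 1 + ((2*c - k) + (-3*c - k))*s^2 + (k*(c + k))*s^4
      = r^2 * (1 - (c + k)*s^2) := by rw [hsq]; ring
  have hdiff : r + c*s^2 / r - s * ((2*c - k)*s / r + c*k*s^3 / r^3)
      = (1 - (c + k)*s^2) / r^3 := by
    field_simp
    linear_combination (r^2 + 1 - c*s^2) * hsq
  rw [hcoef, hdiff]
  field_simp

end
end

section
/- Let b > 0 and k be real constants and m ≥ 1 an integer. Suppose φ is a smooth real-valued function on an open interval I containing 0 with φ(0) = 1, and that Φ(s) := sφ(s) + (b²−s²)φ'(s) satisfies s(1−ks²)Φ'(s) = 2m·Φ(s) on I. Then there exists a constant c such that φ(s) = √(b²−s²)/b + √(b²−s²)·∫₀ˢ c(b²−t²)^{−3/2}(t²/(1−kt²))^m dt for all s ∈ I with |s| < b and 1 − ks² > 0. (Note that Φ'(s) = φ(s) − sφ'(s) + (b²−s²)φ''(s).) -/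
noncomputable section

/-- The smooth solutions of Euler's equation `s F' = n F` on an interval around `0` are the
monomials `c s ^ n`. -/
theorem exists_eq_mul_pow_of_mul_deriv_eq {J : Set ℝ} (hJ : IsOpen J) (hJc : IsPreconnected J)
    (n : ℕ) (F : ℝ → ℝ) (hF : ContDiffOn ℝ (⊤ : ℕ∞) F J)
    (h : ∀ s ∈ J, s * deriv F s = n * F s) : ∃ c : ℝ, ∀ s ∈ J, F s = c * s ^ n := by
  induction n generalizing F with
  | zero =>
    have hd : ContDiffOn ℝ (⊤ : ℕ∞) (deriv F) J := hF.deriv_of_isOpen hJ (by simp)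
    have hne : ∀ s ∈ J, s ≠ 0 → deriv F s = 0 := fun s hs h0 => by
      simpa [h0] using h s hs
    have hz : J.EqOn (deriv F) 0 := by
      intro s hs
      by_cases h0 : s = 0
      · subst h0
        have hc : Filter.Tendsto (deriv F) (nhdsWithin 0 {0}ᶜ) (nhds (deriv F 0)) :=
          (hd.continuousOn.continuousAt (hJ.mem_nhds hs)).tendsto.mono_left nhdsWithin_le_nhds
        refine tendsto_nhds_unique hc (Filter.Tendsto.congr' ?_ tendsto_const_nhds)
        filter_upwards [self_mem_nhdsWithin, mem_nhdsWithin_of_mem_nhds (hJ.mem_nhds hs)]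
          with t ht htJ
        exact (hne t htJ ht).symm
      · exact hne s hs h0
    obtain ⟨c, hc⟩ := hJ.exists_is_const_of_deriv_eq_zero hJc
      (hF.differentiableOn (by simp)) hz
    exact ⟨c, fun s hs => by simp [hc s hs]⟩
  | succ n ih =>
    have hd : ContDiffOn ℝ (⊤ : ℕ∞) (deriv F) J := hF.deriv_of_isOpen hJ (by simp)
    obtain ⟨c, hc⟩ := ih (deriv F) hd fun s hs => by
      have h1 : HasDerivAt F (deriv F s) s :=
        ((hF.differentiableOn (by simp)).differentiableAt (hJ.mem_nhds hs)).hasDerivAt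
      have h2 : HasDerivAt (deriv F) (deriv (deriv F) s) s :=
        ((hd.differentiableOn (by simp)).differentiableAt (hJ.mem_nhds hs)).hasDerivAt
      have h3 := (hasDerivAt_id s).mul h2
      have h4 := h1.const_mul ((n + 1 : ℕ) : ℝ)
      have h5 := h3.unique (h4.congr_of_eventuallyEq
        (Filter.eventually_of_mem (hJ.mem_nhds hs) h))
      simp only [id] at h5
      push_cast at h5
      linarith
    refine ⟨c / (n + 1), fun s hs => ?_⟩
    have hs' := h s hs
    rw [hc s hs] at hs'
    push_cast at hs'
    field_simp
    rw [pow_succ]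
    linarith

/-- The derivative of `φ / √(b² - s²)`. -/
theorem hasDerivAt_mul_rpow_neg_half {b s p : ℝ} {φ : ℝ → ℝ} (hs : 0 < b ^ 2 - s ^ 2)
    (hφ : HasDerivAt φ p s) :
    HasDerivAt (fun t => φ t * (b ^ 2 - t ^ 2) ^ (-(1 : ℝ) / 2))
      ((s * φ s + (b ^ 2 - s ^ 2) * p) * (b ^ 2 - s ^ 2) ^ (-(3 : ℝ) / 2)) s := by
  have h1 : HasDerivAt (fun t : ℝ => b ^ 2 - t ^ 2) (-(2 * s)) s := by
    simpa using (hasDerivAt_pow 2 s).const_sub (b ^ 2)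
  have h2 := hφ.mul (h1.rpow_const (p := -(1 : ℝ) / 2) (Or.inl hs.ne'))
  refine h2.congr_deriv ?_
  have e1 : (-(1 : ℝ) / 2 - 1) = -(3 : ℝ) / 2 := by norm_num
  have e2 : (b ^ 2 - s ^ 2) ^ (-(1 : ℝ) / 2)
      = (b ^ 2 - s ^ 2) ^ (-(3 : ℝ) / 2) * (b ^ 2 - s ^ 2) := by
    rw [← Real.rpow_add_one hs.ne']
    norm_num
  rw [e1, e2]
  ring

/-- On an interval where `1 - k s²` is positive, the smooth solutions of
`s (1 - k s²) Φ' = 2 m Φ` are the multiples of `(s² / (1 - k s²)) ^ m`. -/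
theorem exists_eq_mul_div_pow {J : Set ℝ} (hJ : IsOpen J) (hJc : IsPreconnected J) {k : ℝ}
    (hk : ∀ s ∈ J, 0 < 1 - k * s ^ 2) (m : ℕ) {Φ : ℝ → ℝ} (hΦ : ContDiffOn ℝ (⊤ : ℕ∞) Φ J)
    (h : ∀ s ∈ J, s * (1 - k * s ^ 2) * deriv Φ s = 2 * (m : ℝ) * Φ s) :
    ∃ c : ℝ, ∀ s ∈ J, Φ s = c * (s ^ 2 / (1 - k * s ^ 2)) ^ m := by
  obtain ⟨c, hc⟩ := exists_eq_mul_pow_of_mul_deriv_eq hJ hJc (2 * m)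
    (fun s => Φ s * (1 - k * s ^ 2) ^ m) (hΦ.mul (by fun_prop)) fun s hs => by
      have h1 : HasDerivAt Φ (deriv Φ s) s :=
        ((hΦ.differentiableOn (by simp)).differentiableAt (hJ.mem_nhds hs)).hasDerivAt
      have h2 : HasDerivAt (fun t : ℝ => 1 - k * t ^ 2) (-(k * (2 * s))) s := by
        simpa using ((hasDerivAt_pow 2 s).const_mul k).const_sub 1
      have h3 := (h1.mul (h2.pow m)).deriv
      have h4 := h s hs
      change s * deriv (Φ * (fun t : ℝ => 1 - k * t ^ 2) ^ m) s = _
      rw [h3]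
      simp only [Pi.pow_apply]
      push_cast
      cases m with
      | zero =>
        have := (hk s hs).ne'
        have h5 : s * deriv Φ s = 0 := by
          simp only [Nat.cast_zero, mul_zero, zero_mul] at h4
          rcases mul_eq_zero.1 h4 with h6 | h6
          · rw [(mul_eq_zero.1 h6).resolve_right this, zero_mul]
          · rw [h6, mul_zero]
        simp [h5]
      | succ m =>
        simp only [Nat.add_sub_cancel]
        push_cast at h4 ⊢
        rw [pow_succ]
        linear_combination (1 - k * s ^ 2) ^ m * h4
  refine ⟨c, fun s hs => ?_⟩
  have := (hk s hs).ne'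
  rw [div_pow, ← pow_mul, mul_div_assoc', eq_div_iff (pow_ne_zero _ this)]
  exact hc s hs

/-- solving the ODE `s(1−ks²)Φ' = 2mΦ` for
`Φ(s) = sφ(s) + (b²−s²)φ'(s)` yields the integral formula for `φ`. -/
theorem stmt16 (b k : ℝ) (hb : 0 < b) (m : ℕ) (hm : 1 ≤ m)
    (lo hi : ℝ) (hlo : lo < 0) (hhi : 0 < hi)
    (φ : ℝ → ℝ) (hφ : ContDiffOn ℝ (⊤ : ℕ∞) φ (Set.Ioo lo hi)) (hφ0 : φ 0 = 1)
    (hODE : ∀ s ∈ Set.Ioo lo hi,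
      s * (1 - k*s^2) * deriv (fun t => t * φ t + (b^2 - t^2) * deriv φ t) s
        = 2 * (m:ℝ) * (s * φ s + (b^2 - s^2) * deriv φ s)) :
    ∃ c : ℝ, ∀ s ∈ Set.Ioo lo hi, |s| < b → 1 - k*s^2 > 0 →
      φ s = Real.sqrt (b^2 - s^2) / b + Real.sqrt (b^2 - s^2) *
        ∫ t in (0:ℝ)..s, c * ((b^2 - t^2) ^ (-(3:ℝ)/2)) * (t^2 / (1 - k*t^2))^m := by
  set J : Set ℝ := {s | s ∈ Set.Ioo lo hi ∧ |s| < b ∧ 0 < 1 - k * s ^ 2}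
  have hJ : IsOpen J := by
    have hk : Continuous fun s : ℝ => 1 - k * s ^ 2 := by fun_prop
    exact isOpen_Ioo.inter ((isOpen_lt continuous_abs continuous_const).inter
      (isOpen_lt continuous_const hk))
  have h0 : (0 : ℝ) ∈ J := ⟨⟨hlo, hhi⟩, by simpa using hb, by simp⟩
  have hseg : ∀ s ∈ J, Set.uIcc 0 s ⊆ J := by
    rintro s ⟨hs, hsb, hsk⟩ t ht
    have hts : |t| ≤ |s| := by simpa using Set.abs_sub_left_of_mem_uIcc ht
    have hsq : t ^ 2 ≤ s ^ 2 := sq_le_sq.2 hts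
    refine ⟨Set.ordConnected_Ioo.uIcc_subset ⟨hlo, hhi⟩ hs ht, hts.trans_lt hsb, ?_⟩
    rcases le_total k 0 with hk | hk
    · nlinarith [sq_nonneg t]
    · nlinarith [mul_le_mul_of_nonneg_left hsq hk]
  have hJc : IsPreconnected J := by
    refine isPreconnected_of_forall 0 fun s hs => ?_
    exact ⟨Set.uIcc 0 s, hseg s hs, Set.left_mem_uIcc, Set.right_mem_uIcc, isPreconnected_uIcc⟩
  have hbpos : ∀ s ∈ J, 0 < b ^ 2 - s ^ 2 := fun s hs =>
    sub_pos.2 (sq_lt_sq.2 (hs.2.1.trans_le (le_abs_self b)))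
  have hφJ : ContDiffOn ℝ (⊤ : ℕ∞) φ J := hφ.mono fun s hs => hs.1
  have hφ' : ContDiffOn ℝ (⊤ : ℕ∞) (deriv φ) J := hφJ.deriv_of_isOpen hJ (by simp)
  obtain ⟨c, hc⟩ := exists_eq_mul_div_pow hJ hJc (fun s hs => hs.2.2) m
    (Φ := fun t => t * φ t + (b^2 - t^2) * deriv φ t)
    ((contDiffOn_id.mul hφJ).add (ContDiffOn.mul (by fun_prop) hφ')) fun s hs => hODE s hs.1
  refine ⟨c, fun s hs hsb hsk => ?_⟩
  have hsJ : s ∈ J := ⟨hs, hsb, hsk⟩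
  have hint : ∫ t in (0:ℝ)..s, c * ((b^2 - t^2) ^ (-(3:ℝ)/2)) * (t^2 / (1 - k*t^2))^m
      = φ s * (b ^ 2 - s ^ 2) ^ (-(1 : ℝ) / 2) - φ 0 * (b ^ 2 - 0 ^ 2) ^ (-(1 : ℝ) / 2) := by
    refine intervalIntegral.integral_eq_sub_of_hasDerivAt
      (f := fun t => φ t * (b ^ 2 - t ^ 2) ^ (-(1 : ℝ) / 2)) (fun t ht => ?_)
      (ContinuousOn.intervalIntegrable ?_)
    · have htJ := hseg s hsJ ht
      refine (hasDerivAt_mul_rpow_neg_half (hbpos t htJ)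
        ((hφJ.differentiableOn (by simp)).differentiableAt
          (hJ.mem_nhds htJ)).hasDerivAt).congr_deriv ?_
      rw [show t * φ t + (b ^ 2 - t ^ 2) * deriv φ t = _ from hc t htJ]
      ring
    · refine ContinuousOn.mul (continuousOn_const.mul ?_) (ContinuousOn.pow ?_ m)
      · exact ContinuousOn.rpow_const (by fun_prop)
          fun t ht => Or.inl (hbpos t (hseg s hsJ ht)).ne'
      · exact ContinuousOn.div (by fun_prop) (by fun_prop)
          fun t ht => (hseg s hsJ ht).2.2.ne'
  have hneg : ∀ x : ℝ, 0 ≤ x → x ^ (-(1 : ℝ) / 2) = (Real.sqrt x)⁻¹ := fun x hx => by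
    rw [Real.sqrt_eq_rpow, ← Real.rpow_neg hx]
    norm_num
  have hsqrt : Real.sqrt (b ^ 2 - s ^ 2) ≠ 0 := (Real.sqrt_pos.2 (hbpos s hsJ)).ne'
  rw [hint, hφ0, hneg _ (hbpos s hsJ).le, hneg _ (hbpos 0 h0).le]
  rw [show b ^ 2 - 0 ^ 2 = b ^ 2 by ring, Real.sqrt_sq hb.le]
  field_simp
  ring

end
end

section
/- Let b > 0, k, c be real constants and m ≥ 1 an integer, and define on [0, δ) (with δ ≤ b and 1 − ks² > 0 on [0,δ)) the function φ(s) = √(b²−s²)/b + √(b²−s²)·∫₀ˢ c(b²−t²)^{−3/2}(t²/(1−kt²))^{m−1/2} dt. Then Φ(s) := sφ(s) + (b²−s²)φ'(s) equals c(s²/(1−ks²))^{m−1/2} on (0,δ), and φ satisfies s(1−ks²)·[φ(s) − sφ'(s) + (b²−s²)φ''(s)] = (2m−1)·[sφ(s) + (b²−s²)φ'(s)] for all s ∈ (0, δ). -/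
noncomputable section

open Set

/-- If `I' = w^{-3/2} F` with `w = b² - s²`, then `φ = √w / b + √w I` satisfies `w φ' = F - s φ`. -/
theorem hasDerivAt_sqrt_mul_primitive {b s F : ℝ} {I : ℝ → ℝ} (hw : 0 < b ^ 2 - s ^ 2)
    (hI : HasDerivAt I ((b ^ 2 - s ^ 2) ^ (-(3:ℝ) / 2) * F) s) :
    HasDerivAt (fun u => √(b ^ 2 - u ^ 2) / b + √(b ^ 2 - u ^ 2) * I u)
      ((F - s * (√(b ^ 2 - s ^ 2) / b + √(b ^ 2 - s ^ 2) * I s)) / (b ^ 2 - s ^ 2)) s := by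
  have hsqrt : HasDerivAt (fun u => √(b ^ 2 - u ^ 2)) (-s / √(b ^ 2 - s ^ 2)) s := by
    refine (((hasDerivAt_pow 2 s).const_sub (b ^ 2)).sqrt hw.ne').congr_deriv ?_
    field_simp
    norm_num
  refine ((hsqrt.div_const b).add (hsqrt.mul hI)).congr_deriv ?_
  have hpow : (b ^ 2 - s ^ 2) ^ (-(3:ℝ) / 2) = (√(b ^ 2 - s ^ 2))⁻¹ ^ 3 := by
    rw [Real.sqrt_eq_rpow, ← Real.rpow_neg hw.le, ← Real.rpow_natCast _ 3, ← Real.rpow_mul hw.le]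
    norm_num
  rw [hpow]
  have hpos : 0 < √(b ^ 2 - s ^ 2) := Real.sqrt_pos.2 hw
  have hsq : b ^ 2 - s ^ 2 = √(b ^ 2 - s ^ 2) ^ 2 := (Real.sq_sqrt hw.le).symm
  generalize √(b ^ 2 - s ^ 2) = r at hpos hsq ⊢
  rw [hsq]
  rcases eq_or_ne b 0 with rfl | hb
  · field_simp
    ring
  · field_simp
    ring

/-- The derivative of `(s² / (1 - k s²)) ^ p` is `2 p / (s (1 - k s²))` times the function. -/
theorem hasDerivAt_sq_div_rpow {k s : ℝ} (p : ℝ) (hs : 0 < s) (hk : 0 < 1 - k * s ^ 2) :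
    HasDerivAt (fun u => (u ^ 2 / (1 - k * u ^ 2)) ^ p)
      (2 * p * (s ^ 2 / (1 - k * s ^ 2)) ^ p / (s * (1 - k * s ^ 2))) s := by
  have hsq : HasDerivAt (fun u : ℝ => u ^ 2) (2 * s) s := by
    simpa using hasDerivAt_pow 2 s
  have hpos : 0 < s ^ 2 / (1 - k * s ^ 2) := by positivity
  refine ((hsq.div ((hsq.const_mul k).const_sub 1) hk.ne').rpow_const (p := p)
    (Or.inl hpos.ne')).congr_deriv ?_
  simp only [Pi.div_apply]
  rw [Real.rpow_sub_one hpos.ne']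
  field_simp
  ring

/-- If `w φ' = F - s φ` near `s`, with `w = b² - s²`, then `φ - s φ' + w φ'' = F'` at `s`. -/
theorem sub_mul_deriv_add_mul_deriv_deriv {b s F' : ℝ} {φ F : ℝ → ℝ} (hw : b ^ 2 - s ^ 2 ≠ 0)
    (hφ : ∀ᶠ u in nhds s, HasDerivAt φ ((F u - u * φ u) / (b ^ 2 - u ^ 2)) u)
    (hF : HasDerivAt F F' s) :
    φ s - s * deriv φ s + (b ^ 2 - s ^ 2) * deriv (deriv φ) s = F' := by
  have hsq : HasDerivAt (fun u : ℝ => b ^ 2 - u ^ 2) (-(2 * s)) s := by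
    simpa using (hasDerivAt_pow 2 s).const_sub (b ^ 2)
  have hev : deriv φ =ᶠ[nhds s] fun u => (F u - u * φ u) / (b ^ 2 - u ^ 2) :=
    hφ.mono fun u hu => hu.deriv
  have hφs := hφ.self_of_nhds
  have hderiv := ((hF.sub ((hasDerivAt_id s).mul hφs)).div hsq hw).congr_of_eventuallyEq hev
  rw [hderiv.deriv, hφs.deriv]
  simp only [Pi.sub_apply, Pi.mul_apply, id]
  field_simp
  ring

/-- Derivative of the primitive of `c (b² - t²)^q (t² / (1 - k t²))^p` for `0 ≤ p`. -/
theorem hasDerivAt_integral_rpow_mul_rpow {b k c p s : ℝ} (q : ℝ) (hp : 0 ≤ p) (hs : 0 ≤ s)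
    (hw : ∀ t ∈ Icc 0 s, 0 < b ^ 2 - t ^ 2) (hk : ∀ t ∈ Icc 0 s, 0 < 1 - k * t ^ 2) :
    HasDerivAt (fun u => ∫ t in (0:ℝ)..u, c * (b ^ 2 - t ^ 2) ^ q *
        (t ^ 2 / (1 - k * t ^ 2)) ^ p)
      (c * (b ^ 2 - s ^ 2) ^ q * (s ^ 2 / (1 - k * s ^ 2)) ^ p) s := by
  have hcont : ∀ t ∈ Icc 0 s, ContinuousAt
      (fun t : ℝ => c * (b ^ 2 - t ^ 2) ^ q * (t ^ 2 / (1 - k * t ^ 2)) ^ p) t := by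
    intro t ht
    have hbase : ContinuousAt (fun t : ℝ => b ^ 2 - t ^ 2) t := by fun_prop
    have hquot : ContinuousAt (fun t : ℝ => t ^ 2 / (1 - k * t ^ 2)) t :=
      ContinuousAt.div (by fun_prop) (by fun_prop) (hk t ht).ne'
    exact (continuousAt_const.mul (hbase.rpow_const (Or.inl (hw t ht).ne'))).mul
      (hquot.rpow_const (Or.inr hp))
  have hmeas : Measurable
      (fun t : ℝ => c * (b ^ 2 - t ^ 2) ^ q * (t ^ 2 / (1 - k * t ^ 2)) ^ p) := by
    fun_prop
  refine intervalIntegral.integral_hasDerivAt_right ?_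
    hmeas.stronglyMeasurable.stronglyMeasurableAtFilter (hcont s (right_mem_Icc.2 hs))
  refine ContinuousOn.intervalIntegrable fun t ht => ?_
  rw [uIcc_of_le hs] at ht
  exact (hcont t ht).continuousWithinAt

/-- for the integral formula with exponent `m − 1/2`, the quantity
`Φ(s) = sφ(s) + (b²−s²)φ'(s)` equals `c(s²/(1−ks²))^{m−1/2}` and `φ` satisfies the
corresponding ODE. -/
theorem stmt17 (b k c : ℝ) (hb : 0 < b) (m : ℕ) (hm : 1 ≤ m) (δ : ℝ)
    (hδ : 0 < δ) (hδb : δ ≤ b) (hkδ : ∀ s ∈ Set.Ico (0:ℝ) δ, 1 - k*s^2 > 0) :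
    (∀ s ∈ Set.Ioo (0:ℝ) δ,
      s * (fun u => Real.sqrt (b^2 - u^2) / b + Real.sqrt (b^2 - u^2) *
            ∫ t in (0:ℝ)..u, c * ((b^2 - t^2) ^ (-(3:ℝ)/2)) *
              ((t^2 / (1 - k*t^2)) ^ ((m:ℝ) - 1/2))) s
        + (b^2 - s^2) * deriv (fun u => Real.sqrt (b^2 - u^2) / b + Real.sqrt (b^2 - u^2) *
            ∫ t in (0:ℝ)..u, c * ((b^2 - t^2) ^ (-(3:ℝ)/2)) *
              ((t^2 / (1 - k*t^2)) ^ ((m:ℝ) - 1/2))) s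
      = c * ((s^2 / (1 - k*s^2)) ^ ((m:ℝ) - 1/2))) ∧
    (∀ s ∈ Set.Ioo (0:ℝ) δ,
      s * (1 - k*s^2) *
        ((fun u => Real.sqrt (b^2 - u^2) / b + Real.sqrt (b^2 - u^2) *
            ∫ t in (0:ℝ)..u, c * ((b^2 - t^2) ^ (-(3:ℝ)/2)) *
              ((t^2 / (1 - k*t^2)) ^ ((m:ℝ) - 1/2))) s
          - s * deriv (fun u => Real.sqrt (b^2 - u^2) / b + Real.sqrt (b^2 - u^2) *
              ∫ t in (0:ℝ)..u, c * ((b^2 - t^2) ^ (-(3:ℝ)/2)) *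
                ((t^2 / (1 - k*t^2)) ^ ((m:ℝ) - 1/2))) s
          + (b^2 - s^2) * deriv (deriv (fun u => Real.sqrt (b^2 - u^2) / b +
              Real.sqrt (b^2 - u^2) *
                ∫ t in (0:ℝ)..u, c * ((b^2 - t^2) ^ (-(3:ℝ)/2)) *
                  ((t^2 / (1 - k*t^2)) ^ ((m:ℝ) - 1/2)))) s)
      = (2*(m:ℝ) - 1) *
          (s * (fun u => Real.sqrt (b^2 - u^2) / b + Real.sqrt (b^2 - u^2) *
              ∫ t in (0:ℝ)..u, c * ((b^2 - t^2) ^ (-(3:ℝ)/2)) *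
                ((t^2 / (1 - k*t^2)) ^ ((m:ℝ) - 1/2))) s
            + (b^2 - s^2) * deriv (fun u => Real.sqrt (b^2 - u^2) / b +
                Real.sqrt (b^2 - u^2) *
                  ∫ t in (0:ℝ)..u, c * ((b^2 - t^2) ^ (-(3:ℝ)/2)) *
                    ((t^2 / (1 - k*t^2)) ^ ((m:ℝ) - 1/2))) s)) := by
  have hp : 0 ≤ (m:ℝ) - 1 / 2 := by
    have : (1:ℝ) ≤ m := by exact_mod_cast hm
    linarith
  have hw : ∀ t, 0 ≤ t → t < δ → 0 < b ^ 2 - t ^ 2 := fun t h0 ht => by nlinarith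
  set φ : ℝ → ℝ := fun u => Real.sqrt (b^2 - u^2) / b + Real.sqrt (b^2 - u^2) *
    ∫ t in (0:ℝ)..u, c * ((b^2 - t^2) ^ (-(3:ℝ)/2)) *
      ((t^2 / (1 - k*t^2)) ^ ((m:ℝ) - 1/2))
  have hφ : ∀ s ∈ Ioo (0:ℝ) δ, HasDerivAt φ
      ((c * (s ^ 2 / (1 - k * s ^ 2)) ^ ((m:ℝ) - 1 / 2) - s * φ s) / (b ^ 2 - s ^ 2)) s := by
    rintro s ⟨h0, hs⟩
    refine hasDerivAt_sqrt_mul_primitive (hw s h0.le hs) ?_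
    refine (hasDerivAt_integral_rpow_mul_rpow (-(3:ℝ) / 2) hp h0.le
      (fun t ht => hw t ht.1 (ht.2.trans_lt hs))
      fun t ht => hkδ t ⟨ht.1, ht.2.trans_lt hs⟩).congr_deriv ?_
    ring
  have hΦ : ∀ s ∈ Ioo (0:ℝ) δ, s * φ s + (b ^ 2 - s ^ 2) * deriv φ s =
      c * (s ^ 2 / (1 - k * s ^ 2)) ^ ((m:ℝ) - 1 / 2) := by
    intro s hs
    rw [(hφ s hs).deriv, mul_div_cancel₀ _ (hw s hs.1.le hs.2).ne']
    ring
  refine ⟨hΦ, fun s hs => ?_⟩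
  have hk : 0 < 1 - k * s ^ 2 := hkδ s ⟨hs.1.le, hs.2⟩
  have hs0 : 0 < s := hs.1
  rw [hΦ s hs, sub_mul_deriv_add_mul_deriv_deriv (hw s hs.1.le hs.2).ne'
    (Filter.eventually_of_mem (isOpen_Ioo.mem_nhds hs) hφ)
    ((hasDerivAt_sq_div_rpow _ hs0 hk).const_mul c)]
  generalize (s ^ 2 / (1 - k * s ^ 2)) ^ ((m:ℝ) - 1 / 2) = y
  generalize 1 - k * s ^ 2 = d at hk ⊢
  field_simp

end
end

section
/- Let ε ∈ {1,−1}, and let α = √(a_{ij}(x)yⁱyʲ) and β = b_i(x)yⁱ be a Riemannian metric and a nowhere-zero 1-form on an open subset U ⊆ ℝ² with 0 < b < 1 if ε = 1 and 0 < b < 1/2 if ε = −1. Suppose r_{ij} = 2τ{(1+2εb²)a_{ij} − 3εb_ib_j} + [3/(ε−b²)](b_is_j + b_js_i) for a scalar function τ(x). Define ξ := (1−εb²)³/(1+2εb²)^{3/2}, η := (9/(8b²))·[(1+2εb²)^{3/2} − (1−2εb²+4b⁴)/(1+2εb²)^{3/2}], and the Riemannian metric ã_{ij} := ξ·a_{ij}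 + η·b_ib_j (so α̃ = √(ξα² + ηβ²)). Then the symmetrized covariant derivative of β with respect to α̃ satisfies r̃_{ij} = [2τ(1−εb²)²/(1+2εb²)^{5/2}]·ã_{ij}; in particular β is a conformal 1-form with respect to α̃. -/
open scoped BigOperators
open Real

noncomputable section

/-- If `c_i = a_{ij} v^j`, then `c_k γ^k_{ij}` only involves `v` and the derivatives of `a`. -/
lemma covD_eq_of_lower (a : Pt → Matrix (Fin 2) (Fin 2) ℝ) (c : Pt → Fin 2 → ℝ) (x : Pt)
    (v : Fin 2 → ℝ) (hsym : (a x).IsSymm) (hdet : IsUnit (a x).det)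
    (hv : ∀ i, c x i = ∑ j, a x i j * v j) (i j : Fin 2) :
    covD a c i j x = pd (fun z => c z i) j x - (1/2) * ∑ l, v l *
      (pd (fun z => a z l j) i x + pd (fun z => a z l i) j x - pd (fun z => a z i j) l x) := by
  have hc : c x = Matrix.vecMul v (a x) := by
    rw [← Matrix.mulVec_transpose, hsym.eq]
    funext i
    rw [hv i]
    rfl
  have h : Matrix.vecMul (c x) (a x)⁻¹ = v := by
    rw [hc, Matrix.vecMul_vecMul, Matrix.mul_nonsing_inv _ hdet, Matrix.vecMul_one]
  have h0 := congrFun h 0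
  have h1 := congrFun h 1
  simp only [Matrix.vecMul, dotProduct, Fin.sum_univ_two] at h0 h1
  simp only [covD, christoffel, Fin.sum_univ_two]
  rw [← h0, ← h1]
  ring

lemma lower_bUp (a : Pt → Matrix (Fin 2) (Fin 2) ℝ) (b : Pt → Fin 2 → ℝ) (x : Pt)
    (hdet : IsUnit (a x).det) (i : Fin 2) : b x i = ∑ j, a x i j * bUp a b j x := by
  have h : (a x).mulVec ((a x)⁻¹.mulVec (b x)) = b x := by
    rw [Matrix.mulVec_mulVec, Matrix.mul_nonsing_inv _ hdet, Matrix.one_mulVec]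
  exact (congrFun h i).symm

lemma differentiableAt_bUp (a : Pt → Matrix (Fin 2) (Fin 2) ℝ) (b : Pt → Fin 2 → ℝ) (x : Pt)
    (ha : ∀ i j, DifferentiableAt ℝ (fun z => a z i j) x)
    (hb : ∀ i, DifferentiableAt ℝ (fun z => b z i) x)
    (hdet : (a x).det ≠ 0) (i : Fin 2) : DifferentiableAt ℝ (fun z => bUp a b i z) x := by
  have hd : DifferentiableAt ℝ (fun z => (a z 0 0 * a z 1 1 - a z 0 1 * a z 1 0)⁻¹) x := by
    refine DifferentiableAt.inv (((ha 0 0).mul (ha 1 1)).sub ((ha 0 1).mul (ha 1 0))) ?_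
    rwa [← Matrix.det_fin_two]
  have h00 := ha 0 0
  have h01 := ha 0 1
  have h10 := ha 1 0
  have h11 := ha 1 1
  have hb0 := hb 0
  have hb1 := hb 1
  fin_cases i
  · have e : (fun z => bUp a b 0 z) = fun z =>
        (a z 0 0 * a z 1 1 - a z 0 1 * a z 1 0)⁻¹ * (a z 1 1 * b z 0 - a z 0 1 * b z 1) := by
      funext z
      simp [bUp, Matrix.inv_def, Matrix.adjugate_fin_two, Matrix.det_fin_two]
      ring
    change DifferentiableAt ℝ (fun z => bUp a b 0 z) x
    rw [e]
    exact hd.mul ((h11.mul hb0).sub (h01.mul hb1))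
  · have e : (fun z => bUp a b 1 z) = fun z =>
        (a z 0 0 * a z 1 1 - a z 0 1 * a z 1 0)⁻¹ * (a z 0 0 * b z 1 - a z 1 0 * b z 0) := by
      funext z
      simp [bUp, Matrix.inv_def, Matrix.adjugate_fin_two, Matrix.det_fin_two]
      ring
    change DifferentiableAt ℝ (fun z => bUp a b 1 z) x
    rw [e]
    exact hd.mul ((h00.mul hb1).sub (h10.mul hb0))

lemma pd_mul {f g : Pt → ℝ} {x : Pt} (hf : DifferentiableAt ℝ f x) (hg : DifferentiableAt ℝ g x)
    (k : Fin 2) : pd (fun z => f z * g z) k x = f x * pd g k x + g x * pd f k x := by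
  simp only [pd]
  rw [fderiv_fun_mul hf hg]
  simp

lemma pd_add {f g : Pt → ℝ} {x : Pt} (hf : DifferentiableAt ℝ f x) (hg : DifferentiableAt ℝ g x)
    (k : Fin 2) : pd (fun z => f z + g z) k x = pd f k x + pd g k x := by
  simp only [pd]
  rw [fderiv_fun_add hf hg]
  simp

lemma pd_comp {φ : ℝ → ℝ} {φ' : ℝ} {f : Pt → ℝ} {x : Pt} (hφ : HasDerivAt φ φ' (f x))
    (hf : DifferentiableAt ℝ f x) (k : Fin 2) :
    pd (fun z => φ (f z)) k x = φ' * pd f k x := by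
  have h : HasFDerivAt (fun z => φ (f z)) (φ' • fderiv ℝ f x) x :=
    hφ.comp_hasFDerivAt x hf.hasFDerivAt
  simp [pd, h.fderiv]

lemma pd_congr {f g : Pt → ℝ} {x : Pt} (h : f =ᶠ[nhds x] g) (k : Fin 2) :
    pd f k x = pd g k x := by
  simp only [pd, h.fderiv_eq]

/-- The derivative of the squared norm: `∂_k b² = 2 u^l ∂_k b_l - u^l u^m ∂_k a_{lm}`
with `u^l = b^l`. -/
lemma pd_bsq (a : Pt → Matrix (Fin 2) (Fin 2) ℝ) (b : Pt → Fin 2 → ℝ) (x : Pt)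
    (ha : ∀ i j, DifferentiableAt ℝ (fun z => a z i j) x)
    (hb : ∀ i, DifferentiableAt ℝ (fun z => b z i) x)
    (hsym : (a x).IsSymm) (hdet : ∀ᶠ z in nhds x, IsUnit (a z).det) (k : Fin 2) :
    DifferentiableAt ℝ (bsq a b) x ∧
    pd (bsq a b) k x = 2 * ∑ l, bUp a b l x * pd (fun z => b z l) k x
      - ∑ l, ∑ m, bUp a b l x * bUp a b m x * pd (fun z => a z l m) k x := by
  have hu := differentiableAt_bUp a b x ha hb hdet.self_of_nhds.ne_zero
  have hB : bsq a b = fun z => bUp a b 0 z * b z 0 + bUp a b 1 z * b z 1 := by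
    funext z
    simp [bsq, Fin.sum_univ_two]
  have hbd : ∀ i, pd (fun z => b z i) k x =
      a x i 0 * pd (fun z => bUp a b 0 z) k x + bUp a b 0 x * pd (fun z => a z i 0) k x +
      (a x i 1 * pd (fun z => bUp a b 1 z) k x + bUp a b 1 x * pd (fun z => a z i 1) k x) := by
    intro i
    have e : (fun z => b z i) =ᶠ[nhds x]
        fun z => a z i 0 * bUp a b 0 z + a z i 1 * bUp a b 1 z := by
      filter_upwards [hdet] with z hz
      rw [lower_bUp a b z hz i, Fin.sum_univ_two]
    rw [pd_congr e, pd_add ((ha i 0).fun_mul (hu 0)) ((ha i 1).fun_mul (hu 1)),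
      pd_mul (ha i 0) (hu 0), pd_mul (ha i 1) (hu 1)]
  have hlow := lower_bUp a b x hdet.self_of_nhds
  have h10 : a x 1 0 = a x 0 1 := congrFun (congrFun hsym.eq 0) 1
  refine ⟨hB ▸ ((hu 0).mul (hb 0)).add ((hu 1).mul (hb 1)), ?_⟩
  rw [hB, pd_add ((hu 0).fun_mul (hb 0)) ((hu 1).fun_mul (hb 1)), pd_mul (hu 0) (hb 0),
    pd_mul (hu 1) (hb 1)]
  have hl0 := hlow 0
  have hl1 := hlow 1
  simp only [Fin.sum_univ_two] at hl0 hl1 ⊢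
  rw [hbd 0, hbd 1, hl0, hl1, h10]
  ring

lemma rpow_five_halves {w : ℝ} (hw : 0 < w) : w ^ ((5:ℝ)/2) = w * w ^ ((3:ℝ)/2) := by
  rw [show (5:ℝ)/2 = 1 + 3/2 by norm_num, rpow_add hw, rpow_one]

lemma rpow_three_halves_sq {w : ℝ} (hw : 0 < w) : (w ^ ((3:ℝ)/2)) ^ 2 = w ^ 3 := by
  rw [← rpow_natCast (w ^ ((3:ℝ)/2)), ← rpow_mul hw.le, ← rpow_natCast w]
  norm_num

lemma hasDerivAt_rpow_three_halves (ε : ℝ) {s : ℝ} (hw : 0 < 1 + 2*ε*s) :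
    HasDerivAt (fun s => (1 + 2*ε*s) ^ ((3:ℝ)/2))
      (3 * ε * (1 + 2*ε*s) ^ ((3:ℝ)/2) / (1 + 2*ε*s)) s := by
  have h1 : HasDerivAt (fun s : ℝ => 1 + 2*ε*s) (2*ε) s := by
    simpa using ((hasDerivAt_id s).const_mul (2*ε)).const_add 1
  convert h1.rpow_const (p := (3:ℝ)/2) (Or.inl hw.ne') using 1
  rw [rpow_sub_one hw.ne']
  ring

/-- The coefficient `ξ` as a function of `b²`. -/
def xiFun (ε s : ℝ) : ℝ := (1 - ε * s)^3 / (1 + 2*ε*s) ^ ((3:ℝ)/2)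

/-- The coefficient `η` as a function of `b²`. -/
def etaFun (ε s : ℝ) : ℝ := (9 / (8 * s)) *
  ((1 + 2*ε*s) ^ ((3:ℝ)/2) - (1 - 2*ε*s + 4*s^2) / (1 + 2*ε*s) ^ ((3:ℝ)/2))

lemma etaFun_eq {ε s : ℝ} (hε : ε^2 = 1) (hs : s ≠ 0) (hw : 0 < 1 + 2*ε*s) :
    etaFun ε s = 9 * ε * (1 + ε*s + s^2) / (1 + 2*ε*s) ^ ((3:ℝ)/2) := by
  have hq := rpow_pos_of_pos hw ((3:ℝ)/2)
  have h2 := rpow_three_halves_sq hw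
  rw [etaFun]
  generalize (1 + 2*ε*s) ^ ((3:ℝ)/2) = q at *
  field_simp
  linear_combination h2 + (4 * s^2 + 8 * s^3 * ε) * hε

lemma hasDerivAt_xiFun (ε : ℝ) {s : ℝ} (hw : 0 < 1 + 2*ε*s) :
    HasDerivAt (xiFun ε) (-3 * ε * (1 - ε*s)^2 * (2 + ε*s) /
      ((1 + 2*ε*s) * (1 + 2*ε*s) ^ ((3:ℝ)/2))) s := by
  have hq := rpow_pos_of_pos hw ((3:ℝ)/2)
  have h1 : HasDerivAt (fun s : ℝ => (1 - ε*s)^3) (3 * (1 - ε*s)^2 * (-ε)) s := by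
    simpa using (((hasDerivAt_id' s).const_mul ε).const_sub 1).fun_pow 3
  refine (h1.fun_div (hasDerivAt_rpow_three_halves ε hw) hq.ne').congr_deriv ?_
  generalize (1 + 2*ε*s) ^ ((3:ℝ)/2) = q at *
  generalize hwdef : 1 + 2*ε*s = w at *
  field_simp
  subst hwdef
  ring

lemma hasDerivAt_etaFun {ε s : ℝ} (hε : ε^2 = 1) (hs : s ≠ 0) (hw : 0 < 1 + 2*ε*s) :
    HasDerivAt (etaFun ε) (9 * (ε*s - 1) * (ε*s + 2) /
      ((1 + 2*ε*s) * (1 + 2*ε*s) ^ ((3:ℝ)/2))) s := by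
  have hq := rpow_pos_of_pos hw ((3:ℝ)/2)
  have h1 : HasDerivAt (fun s : ℝ => 9 * ε * (1 + ε*s + s^2)) (9 * ε * (ε + 2 * s)) s := by
    have h := ((((hasDerivAt_id' s).const_mul ε).const_add 1).fun_add
      ((hasDerivAt_id' s).fun_pow 2)).const_mul (9 * ε)
    simpa using h
  have e : etaFun ε =ᶠ[nhds s]
      fun s => 9 * ε * (1 + ε*s + s^2) / (1 + 2*ε*s) ^ ((3:ℝ)/2) := by
    have hc : ContinuousAt (fun s : ℝ => 1 + 2*ε*s) s := by fun_prop
    filter_upwards [eventually_ne_nhds hs, hc.eventually_const_lt hw] with r hr hr'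
    exact etaFun_eq hε hr hr'
  refine HasDerivAt.congr_of_eventuallyEq ?_ e
  refine (h1.fun_div (hasDerivAt_rpow_three_halves ε hw) hq.ne').congr_deriv ?_
  generalize (1 + 2*ε*s) ^ ((3:ℝ)/2) = q at *
  generalize hwdef : 1 + 2*ε*s = w at *
  field_simp
  subst hwdef
  linear_combination -(2 + ε*s) * hε

/-- The change of `r_{ij}` under `ã = ξ a + η b ⊗ b`, as an identity between the components at a
point: `A, DA, Db` are `a` and the derivatives of `a` and `b`, and `u` is the vector `bⁱ`. -/
lemma deformed_rr_components (A : Fin 2 → Fin 2 → ℝ) (DA : Fin 2 → Fin 2 → Fin 2 → ℝ)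
    (u c s dB : Fin 2 → ℝ) (Db : Fin 2 → Fin 2 → ℝ) (ξ η ξ' η' B ρ : ℝ)
    (DT : Fin 2 → Fin 2 → Fin 2 → ℝ)
    (hA : A 1 0 = A 0 1) (hDA : ∀ k, DA 1 0 k = DA 0 1 k)
    (hc : ∀ i, c i = A i 0 * u 0 + A i 1 * u 1)
    (hB : B = u 0 * c 0 + u 1 * c 1) (hρ : ρ = ξ + η * B)
    (hs : ∀ j, s j = u 0 * ((Db 0 j - Db j 0) / 2) + u 1 * ((Db 1 j - Db j 1) / 2))
    (hDT : ∀ i j k, DT i j k = ξ' * dB k * A i j + ξ * DA i j k + η' * dB k * c i * c j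
      + η * (Db i k * c j + c i * Db j k)) (i j : Fin 2) :
    ρ * ((Db i j + Db j i) / 2) - (1/2) * (u 0 * (DT 0 j i + DT 0 i j - DT i j 0)
        + u 1 * (DT 1 j i + DT 1 i j - DT i j 1)) =
      ξ * ((Db i j + Db j i) / 2 - (1/2) * (u 0 * (DA 0 j i + DA 0 i j - DA i j 0)
        + u 1 * (DA 1 j i + DA 1 i j - DA i j 1)))
      - (ξ' + B * η') * (1/2) * (dB i * c j + dB j * c i) - η * (s i * c j + s j * c i)
      + (1/2) * (ξ' * A i j + η' * c i * c j) * (u 0 * dB 0 + u 1 * dB 1) := by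
  simp only [hDT, hs, hρ, hB]
  have hc0 := hc 0
  have hc1 := hc 1
  fin_cases i <;> fin_cases j <;> simp only [Fin.zero_eta, Fin.mk_one, hc0, hc1, hA, hDA] <;>
    ring

/-- The same change under the structure equation for `r_{ij}`, when the coefficients satisfy the
three relations `hξ`, `hη`, `hκ`: the result is a multiple `2τμ` of `ã`. -/
lemma deformed_conformal_components (A R : Fin 2 → Fin 2 → ℝ) (u c s : Fin 2 → ℝ)
    (ε τ κ w ξ η ξ' η' B ρ μ : ℝ)
    (hA : A 1 0 = A 0 1)
    (hc : ∀ i, c i = A i 0 * u 0 + A i 1 * u 1)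
    (hB : B = u 0 * c 0 + u 1 * c 1) (hw : w = 1 + 2 * ε * B)
    (hsu : u 0 * s 0 + u 1 * s 1 = 0)
    (hR : ∀ i j, R i j = 2 * τ * (w * A i j - 3 * ε * c i * c j) + κ * (c i * s j + c j * s i))
    (hξ : ξ * w + ξ' * (1 - ε * B) * B = ρ * μ * ξ)
    (hη : -3 * ε * ξ - 2 * (ξ' + B * η') * (1 - ε * B) + η' * (1 - ε * B) * B = ρ * μ * η)
    (hκ : ξ * κ - (ξ' + B * η') * (1 + κ * B) - η = 0)
    (dB : Fin 2 → ℝ) (hdB : ∀ k, dB k = 2 * (u 0 * R 0 k + u 1 * R 1 k + s k)) (i j : Fin 2) :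
    ξ * R i j - (ξ' + B * η') * (1/2) * (dB i * c j + dB j * c i) - η * (s i * c j + s j * c i)
      + (1/2) * (ξ' * A i j + η' * c i * c j) * (u 0 * dB 0 + u 1 * dB 1)
      = ρ * (2 * τ * μ * (ξ * A i j + η * c i * c j)) := by
  have hAu : ∀ k, u 0 * A 0 k + u 1 * A 1 k = c k := by
    intro k
    have h := hc k
    fin_cases k <;> simp only [Fin.zero_eta, Fin.mk_one, hA] at h ⊢ <;> linarith
  have hd : ∀ k, dB k = 2 * (2 * τ * (1 - ε * B) * c k + (1 + κ * B) * s k) := by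
    intro k
    rw [hdB, hR, hR, hw]
    linear_combination 4 * τ * (1 + 2 * ε * B) * hAu k
      + (12 * τ * ε * c k - 2 * κ * s k) * hB + 2 * κ * c k * hsu
  have hud : u 0 * dB 0 + u 1 * dB 1 = 4 * τ * (1 - ε * B) * B := by
    rw [hd, hd]
    linear_combination -4 * τ * (1 - ε * B) * hB + 2 * (1 + κ * B) * hsu
  rw [hud, hd, hd, hR]
  linear_combination 2 * τ * A i j * hξ + 2 * τ * c i * c j * hη
    + (c i * s j + c j * s i) * hκ

/-- The conformal equation at a point of `U`, for the metric `ã = ξ a + η b ⊗ b`. -/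
lemma rr_deformed (ε : ℝ) (hε : ε^2 = 1) (a at' : Pt → Matrix (Fin 2) (Fin 2) ℝ)
    (b : Pt → Fin 2 → ℝ) (x : Pt) (τ : ℝ)
    (ha : ∀ i j, DifferentiableAt ℝ (fun z => a z i j) x)
    (hb : ∀ i, DifferentiableAt ℝ (fun z => b z i) x)
    (hsym : ∀ᶠ z in nhds x, ∀ i j, a z i j = a z j i)
    (hdet : ∀ᶠ z in nhds x, IsUnit (a z).det)
    (hB0 : bsq a b x ≠ 0) (hw : 0 < 1 + 2*ε*bsq a b x) (ht : 1 - ε * bsq a b x ≠ 0)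
    (hr : ∀ i j, rr a b i j x =
      2 * τ * ((1 + 2*ε*bsq a b x) * a x i j - 3 * ε * b x i * b x j)
      + (3 / (ε - bsq a b x)) * (b x i * sLow a b j x + b x j * sLow a b i x))
    (hat : ∀ z i j, at' z i j =
      xiFun ε (bsq a b z) * a z i j + etaFun ε (bsq a b z) * b z i * b z j) (i j : Fin 2) :
    rr at' b i j x =
      (2 * τ * (1 - ε * bsq a b x)^2 / (1 + 2*ε*bsq a b x) ^ ((5:ℝ)/2)) * at' x i j := by
  have hsymx : (a x).IsSymm := Matrix.IsSymm.ext fun i j => hsym.self_of_nhds j i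
  have hdetx := hdet.self_of_nhds
  have hBd := fun k => (pd_bsq a b x ha hb hsymx hdet k).2
  have hBdiff := (pd_bsq a b x ha hb hsymx hdet 0).1
  have hlow := lower_bUp a b x hdetx
  have hDA : ∀ k, pd (fun z => a z 1 0) k x = pd (fun z => a z 0 1) k x := fun k =>
    pd_congr (hsym.mono fun z hz => hz 1 0) k
  have hBu : bsq a b x = bUp a b 0 x * b x 0 + bUp a b 1 x * b x 1 := by
    simp [bsq, Fin.sum_univ_two]
  have hξd := hasDerivAt_xiFun ε hw
  have hηd := hasDerivAt_etaFun hε hB0 hw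
  have hηx := etaFun_eq hε hB0 hw
  have hq := rpow_pos_of_pos hw ((3:ℝ)/2)
  have hq2 := rpow_three_halves_sq hw
  have hcov := covD_eq_of_lower a b x (fun l => bUp a b l x) hsymx hdetx hlow
  have hso : ∀ i j, so a b i j x = (pd (fun z => b z i) j x - pd (fun z => b z j) i x) / 2 := by
    intro i j
    rw [so, hcov, hcov]
    have h : ∀ l, pd (fun z => a z i j) l x = pd (fun z => a z j i) l x := fun l =>
      pd_congr (hsym.mono fun z hz => hz i j) l
    simp only [Fin.sum_univ_two, h]
    ring
  have hs : ∀ j, sLow a b j x =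
      bUp a b 0 x * ((pd (fun z => b z 0) j x - pd (fun z => b z j) 0 x) / 2)
      + bUp a b 1 x * ((pd (fun z => b z 1) j x - pd (fun z => b z j) 1 x) / 2) := by
    intro j
    simp only [sLow, Fin.sum_univ_two, hso]
  have hrr : ∀ i j, rr a b i j x =
      (pd (fun z => b z i) j x + pd (fun z => b z j) i x) / 2 - (1/2) *
      (bUp a b 0 x * (pd (fun z => a z 0 j) i x + pd (fun z => a z 0 i) j x
          - pd (fun z => a z i j) 0 x)
        + bUp a b 1 x * (pd (fun z => a z 1 j) i x + pd (fun z => a z 1 i) j x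
          - pd (fun z => a z i j) 1 x)) := by
    intro i j
    rw [rr, hcov, hcov]
    have h : ∀ l, pd (fun z => a z i j) l x = pd (fun z => a z j i) l x := fun l =>
      pd_congr (hsym.mono fun z hz => hz i j) l
    simp only [Fin.sum_univ_two, h]
    ring
  have hξdiff : DifferentiableAt ℝ (fun z => xiFun ε (bsq a b z)) x :=
    hξd.differentiableAt.comp x hBdiff
  have hηdiff : DifferentiableAt ℝ (fun z => etaFun ε (bsq a b z)) x :=
    hηd.differentiableAt.comp x hBdiff
  have hDT : ∀ i j k, pd (fun z => at' z i j) k x =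
      (-3 * ε * (1 - ε * bsq a b x)^2 * (2 + ε * bsq a b x) /
        ((1 + 2*ε*bsq a b x) * (1 + 2*ε*bsq a b x) ^ ((3:ℝ)/2))) * pd (bsq a b) k x * a x i j
      + xiFun ε (bsq a b x) * pd (fun z => a z i j) k x
      + (9 * (ε * bsq a b x - 1) * (ε * bsq a b x + 2) /
        ((1 + 2*ε*bsq a b x) * (1 + 2*ε*bsq a b x) ^ ((3:ℝ)/2))) * pd (bsq a b) k x
          * b x i * b x j
      + etaFun ε (bsq a b x) * (pd (fun z => b z i) k x * b x j
        + b x i * pd (fun z => b z j) k x) := by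
    intro i j k
    have e : (fun z => at' z i j) = fun z => xiFun ε (bsq a b z) * a z i j
        + etaFun ε (bsq a b z) * b z i * b z j := funext fun z => hat z i j
    rw [e, pd_add (hξdiff.fun_mul (ha i j)) ((hηdiff.fun_mul (hb i)).fun_mul (hb j)),
      pd_mul hξdiff (ha i j), pd_mul (hηdiff.fun_mul (hb i)) (hb j), pd_mul hηdiff (hb i),
      pd_comp hξd hBdiff, pd_comp hηd hBdiff]
    ring
  have hξx : xiFun ε (bsq a b x) = (1 - ε * bsq a b x)^3 / (1 + 2*ε*bsq a b x) ^ ((3:ℝ)/2) := rfl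
  have hρ : xiFun ε (bsq a b x) + etaFun ε (bsq a b x) * bsq a b x =
      (1 + 2*ε*bsq a b x) ^ ((3:ℝ)/2) := by
    rw [hηx, hξx]
    generalize (1 + 2*ε*bsq a b x) ^ ((3:ℝ)/2) = q at *
    field_simp
    rw [hq2]
    linear_combination -(9 * ε * (bsq a b x)^3) * hε
  have hl0 := hlow 0
  have hl1 := hlow 1
  simp only [Fin.sum_univ_two] at hl0 hl1
  have h10 : a x 1 0 = a x 0 1 := hsym.self_of_nhds 1 0
  have hsymt : (at' x).IsSymm := Matrix.IsSymm.ext fun i j => by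
    rw [hat, hat, hsym.self_of_nhds j i]
    ring
  have hdett : IsUnit (at' x).det := by
    have h : (at' x).det = xiFun ε (bsq a b x) *
        (xiFun ε (bsq a b x) + etaFun ε (bsq a b x) * bsq a b x) * (a x).det := by
      simp only [Matrix.det_fin_two, hat, hBu, hl0, hl1, h10]
      ring
    rw [h, hρ, hξx]
    exact ((mul_ne_zero (div_ne_zero (pow_ne_zero 3 ht) hq.ne') hq.ne').isUnit).mul hdetx
  have hlowt : ∀ i, b x i = ∑ j, at' x i j *
      (bUp a b j x / (xiFun ε (bsq a b x) + etaFun ε (bsq a b x) * bsq a b x)) := by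
    intro i
    have hne : xiFun ε (bsq a b x) + etaFun ε (bsq a b x) * bsq a b x ≠ 0 := hρ ▸ hq.ne'
    have hli := hlow i
    simp only [Fin.sum_univ_two, hat] at hli ⊢
    field_simp
    rw [hBu]
    linear_combination xiFun ε (bUp a b 0 x * b x 0 + bUp a b 1 x * b x 1) * hli
  have hcovt := covD_eq_of_lower at' b x _ hsymt hdett hlowt
  have hrrt : (1 + 2*ε*bsq a b x) ^ ((3:ℝ)/2) * rr at' b i j x =
      (1 + 2*ε*bsq a b x) ^ ((3:ℝ)/2) *
        ((pd (fun z => b z i) j x + pd (fun z => b z j) i x) / 2) - (1/2) *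
      (bUp a b 0 x * (pd (fun z => at' z 0 j) i x + pd (fun z => at' z 0 i) j x
          - pd (fun z => at' z i j) 0 x)
        + bUp a b 1 x * (pd (fun z => at' z 1 j) i x + pd (fun z => at' z 1 i) j x
          - pd (fun z => at' z i j) 1 x)) := by
    have h : ∀ l, pd (fun z => at' z i j) l x = pd (fun z => at' z j i) l x := fun l =>
      pd_congr (hsym.mono fun z hz => by
        rw [hat, hat, hz i j]
        ring) l
    rw [rr, hcovt, hcovt, hρ]
    simp only [Fin.sum_univ_two, h]
    field_simp
    ring
  have hcomp := deformed_rr_components (fun i j => a x i j)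
    (fun i j k => pd (fun z => a z i j) k x) (fun l => bUp a b l x) (b x)
    (fun l => sLow a b l x) (fun k => pd (bsq a b) k x) (fun i k => pd (fun z => b z i) k x)
    _ _ _ _ _ _ _ h10 hDA (fun i => by rw [hlow i, Fin.sum_univ_two]) hBu hρ.symm hs hDT i j
  have hconf := deformed_conformal_components (fun i j => a x i j) (fun i j => rr a b i j x)
    (fun l => bUp a b l x) (b x) (fun l => sLow a b l x) ε τ (3 / (ε - bsq a b x))
    (1 + 2*ε*bsq a b x) (xiFun ε (bsq a b x)) (etaFun ε (bsq a b x))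
    (-3 * ε * (1 - ε * bsq a b x)^2 * (2 + ε * bsq a b x) /
        ((1 + 2*ε*bsq a b x) * (1 + 2*ε*bsq a b x) ^ ((3:ℝ)/2)))
    (9 * (ε * bsq a b x - 1) * (ε * bsq a b x + 2) /
        ((1 + 2*ε*bsq a b x) * (1 + 2*ε*bsq a b x) ^ ((3:ℝ)/2)))
    (bsq a b x) ((1 + 2*ε*bsq a b x) ^ ((3:ℝ)/2))
    ((1 - ε * bsq a b x)^2 / (1 + 2*ε*bsq a b x) ^ ((5:ℝ)/2))
    h10 (fun i => by rw [hlow i, Fin.sum_univ_two]) hBu rfl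
    (by simp only [hs]; ring) hr
    (by
      rw [rpow_five_halves hw, hξx]
      generalize (1 + 2*ε*bsq a b x) ^ ((3:ℝ)/2) = q at *
      generalize hwdef : 1 + 2*ε*bsq a b x = w at *
      field_simp
      subst hwdef
      obtain h | h := sq_eq_one_iff.mp hε <;> subst h <;> ring)
    (by
      rw [rpow_five_halves hw, hξx, hηx]
      generalize (1 + 2*ε*bsq a b x) ^ ((3:ℝ)/2) = q at *
      generalize hwdef : 1 + 2*ε*bsq a b x = w at *
      field_simp
      subst hwdef
      obtain h | h := sq_eq_one_iff.mp hε <;> subst h <;> ring)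
    (by
      have hκ0 : ε - bsq a b x ≠ 0 := fun h => ht (by linear_combination ε * h - hε)
      have hκ : 3 / (ε - bsq a b x) = 3 * ε / (1 - ε * bsq a b x) := by
        rw [div_eq_div_iff hκ0 ht]
        linear_combination -3 * hε
      rw [hκ, hξx, hηx]
      generalize (1 + 2*ε*bsq a b x) ^ ((3:ℝ)/2) = q at *
      generalize hwdef : 1 + 2*ε*bsq a b x = w at *
      field_simp
      subst hwdef
      obtain h | h := sq_eq_one_iff.mp hε <;> subst h <;> ring)
    (fun k => pd (bsq a b) k x)
    (by
      intro k
      simp only [hrr, hs, hBd, Fin.sum_univ_two, hDA]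
      fin_cases k <;> simp only [Fin.zero_eta, Fin.mk_one, hDA] <;> ring) i j
  apply mul_left_cancel₀ hq.ne'
  rw [hrrt, hat]
  simp only [hrr] at hconf
  rw [hcomp, hconf]
  ring


/-- the metric deformation in the proof of Theorem 1.2: `β` becomes a
conformal 1-form with respect to the deformed metric `α̃² = ξα² + ηβ²`. -/
theorem stmt18 (ε : ℝ) (hε : ε = 1 ∨ ε = -1)
    (U : Set Pt) (hU : IsOpen U)
    (a : Pt → Matrix (Fin 2) (Fin 2) ℝ) (b : Pt → Fin 2 → ℝ)
    (ha : ∀ i j, ContDiffOn ℝ (⊤ : ℕ∞) (fun x => a x i j) U)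
    (hsym : ∀ x ∈ U, ∀ i j, a x i j = a x j i)
    (hpos : ∀ x ∈ U, (a x).PosDef)
    (hb : ∀ i, ContDiffOn ℝ (⊤ : ℕ∞) (fun x => b x i) U)
    (hbne : ∀ x ∈ U, b x ≠ 0)
    (hrange1 : ε = 1 → ∀ x ∈ U, 0 < bsq a b x ∧ bsq a b x < 1)
    (hrange2 : ε = -1 → ∀ x ∈ U, 0 < bsq a b x ∧ bsq a b x < 1/4)
    (τ : Pt → ℝ)
    (hr : ∀ x ∈ U, ∀ i j, rr a b i j x =
      2 * τ x * ((1 + 2*ε*bsq a b x) * a x i j - 3 * ε * b x i * b x j)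
      + (3 / (ε - bsq a b x)) * (b x i * sLow a b j x + b x j * sLow a b i x))
    (at' : Pt → Matrix (Fin 2) (Fin 2) ℝ)
    (hat : ∀ x, at' x = Matrix.of fun i j =>
      ((1 - ε * bsq a b x)^3 / (1 + 2*ε*bsq a b x) ^ ((3:ℝ)/2)) * a x i j
      + ((9 / (8 * bsq a b x)) *
          ((1 + 2*ε*bsq a b x) ^ ((3:ℝ)/2)
            - (1 - 2*ε*bsq a b x + 4*(bsq a b x)^2) / (1 + 2*ε*bsq a b x) ^ ((3:ℝ)/2)))
        * b x i * b x j) :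
    (∀ x ∈ U, ∀ i j, rr at' b i j x =
      (2 * τ x * (1 - ε * bsq a b x)^2 / (1 + 2*ε*bsq a b x) ^ ((5:ℝ)/2)) * at' x i j) ∧
    -- in particular β is conformal with respect to α̃
    (∃ lam : Pt → ℝ, ∀ x ∈ U, ∀ i j, rr at' b i j x = lam x * at' x i j) := by
  have hε2 : ε^2 = 1 := by rcases hε with rfl | rfl <;> norm_num
  have key : ∀ x ∈ U, ∀ i j, rr at' b i j x =
      (2 * τ x * (1 - ε * bsq a b x)^2 / (1 + 2*ε*bsq a b x) ^ ((5:ℝ)/2)) * at' x i j := by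
    intro x hx i j
    have hnhds := hU.mem_nhds hx
    have hB : 0 < bsq a b x ∧ 0 < 1 + 2*ε*bsq a b x ∧ 0 < 1 - ε * bsq a b x := by
      rcases hε with h | h
      · obtain ⟨h1, h2⟩ := hrange1 h x hx
        subst h
        exact ⟨h1, by linarith, by linarith⟩
      · obtain ⟨h1, h2⟩ := hrange2 h x hx
        subst h
        exact ⟨h1, by linarith, by linarith⟩
    refine rr_deformed ε hε2 a at' b x (τ x)
      (fun i j => ((ha i j).contDiffAt hnhds).differentiableAt (by simp))
      (fun i => ((hb i).contDiffAt hnhds).differentiableAt (by simp))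
      (Filter.eventually_of_mem hnhds hsym)
      (Filter.eventually_of_mem hnhds fun z hz => (hpos z hz).det_pos.ne'.isUnit)
      hB.1.ne' hB.2.1 hB.2.2.ne' (hr x hx) (fun z i j => ?_) i j
    rw [hat z]
    rfl
  exact ⟨key, _, key⟩

end
end
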